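/- Let K be a compact subset of ℝ^{2n+1} and s ∈ ℝ. Then there exists a positive constant C_{K,s} > 0 such that for all u ∈ C_0^∞(ℝ^{2n+1}) with support contained in K, one has ‖(1 + |D_t|^{2σ/(2σ+1)} + |D_x|^{2σ/(2σ+1)} + |D_v|^{2σ}) u‖_s ≤ C_{K,s} (‖Pu‖_s + ‖u‖_s). -/

import Mathlib

open MeasureTheory
open scoped ENNReal Real

noncomputable section

/-- `ℝ^n` with the Euclidean norm. -/
abbrev E (n : ℕ) : Type := EuclideanSpace ℝ (Fin n)
/-- `ℝ^{2n+1} = ℝ_t × ℝ^n_x × ℝ^n_v` with the Euclidean norm. -/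
abbrev Z (n : ℕ) : Type := EuclideanSpace ℝ (Unit ⊕ Fin n ⊕ Fin n)

variable {n : ℕ}

/-- the `t` (resp. dual `τ`) coordinate -/
def tC (ζ : Z n) : ℝ := ζ (Sum.inl ())
/-- the `x` (resp. dual `ξ`) coordinates -/
def xC (ζ : Z n) : E n := WithLp.toLp 2 (fun i => ζ (Sum.inr (Sum.inl i)))
/-- the `v` (resp. dual `η`) coordinates -/
def vC (ζ : Z n) : E n := WithLp.toLp 2 (fun i => ζ (Sum.inr (Sum.inr i)))

/-- the unit vector in the `t` direction -/
def eT : Z n := EuclideanSpace.single (Sum.inl ()) 1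
/-- the unit vector in the `xᵢ` direction -/
def eX (i : Fin n) : Z n := EuclideanSpace.single (Sum.inr (Sum.inl i)) 1

/-- the symbol `F(η) = |η|^{2σ} w(η) + |η|² (1 - w(η))` -/
def Fsym (σ : ℝ) (w : E n → ℝ) (η : E n) : ℝ :=
  ‖η‖ ^ (2 * σ) * w η + ‖η‖ ^ 2 * (1 - w η)

/-- the fractional Laplacian `(-Δ̃_v)^σ`, the Fourier multiplier with symbol `F(η)` -/
def fracLap (σ : ℝ) (w : E n → ℝ) (u : Z n → ℂ) : Z n → ℂ :=
  FourierTransformInv.fourierInv (fun ζ => (Fsym σ w (vC ζ) : ℂ) * FourierTransform.fourier u ζ)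

/-- the kinetic operator `P = ∂_t + v⋅∂_x + a(t,x,v) (-Δ̃_v)^σ` -/
def Pop (σ : ℝ) (w : E n → ℝ) (a : Z n → ℝ) (u : Z n → ℂ) (z : Z n) : ℂ :=
  fderiv ℝ u z eT + ∑ i : Fin n, (vC z i : ℂ) * fderiv ℝ u z (eX i)
    + (a z : ℂ) * fracLap σ w u z

/-- the Sobolev `H^s(ℝ^{2n+1})` norm `‖⟨ζ⟩^s 𝓕f‖_{L²}` -/
def sobNorm (s : ℝ) (f : Z n → ℂ) : ℝ≥0∞ :=
  eLpNorm (fun ζ => (((1 + ‖ζ‖ ^ 2) ^ (s / 2) : ℝ) : ℂ) * FourierTransform.fourier f ζ) 2 volume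

/-- the `H^s` norm of `(1 + |D_t|^{2σ/(2σ+1)} + |D_x|^{2σ/(2σ+1)} + |D_v|^{2σ}) u`,
computed on the Fourier transform side -/
def lhsNorm (σ s : ℝ) (u : Z n → ℂ) : ℝ≥0∞ :=
  eLpNorm (fun ζ => (((1 + ‖ζ‖ ^ 2) ^ (s / 2) *
      (1 + |tC ζ| ^ (2 * σ / (2 * σ + 1)) + ‖xC ζ‖ ^ (2 * σ / (2 * σ + 1))
        + ‖vC ζ‖ ^ (2 * σ)) : ℝ) : ℂ) * FourierTransform.fourier u ζ) 2 volume

open scoped SchwartzMap FourierTransform LineDeriv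

namespace Hypo

open Function

/-! ### Temperate growth of powers -/

lemma tg_rpow {V : Type*} [NormedAddCommGroup V] [NormedSpace ℝ V] {T : V → ℝ}
    (hT : T.HasTemperateGrowth) (h1 : ∀ ζ, 1 ≤ T ζ) (r : ℝ) :
    (fun ζ => T ζ ^ r).HasTemperateGrowth := by
  set t := {y : ℝ | 1 / 2 < y}
  have ht : Set.range T ⊆ t := by
    rintro - ⟨y, rfl⟩
    have := h1 y
    show 1 / 2 < T y
    linarith
  have hdiff : ContDiffOn ℝ (⊤ : ℕ∞) (fun x : ℝ ↦ x ^ r) t :=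
    contDiffOn_fun_id.rpow_const_of_ne fun x hx ↦ (lt_trans (by norm_num) hx).ne'
  have hunique : UniqueDiffOn ℝ t := (isOpen_lt' (1 / 2)).uniqueDiffOn
  refine HasTemperateGrowth.comp' (g := fun x : ℝ => x ^ r) ht hunique hdiff ?_ hT
  intro N
  obtain ⟨k, hk⟩ := exists_nat_ge (max r 0)
  have hk₁ : r ≤ k := le_sup_left.trans hk
  refine ⟨k, (∑ k ∈ Finset.range (N + 1), ‖Polynomial.eval r (descPochhammer ℝ k)‖) *
    2 ^ (|r| + N), by positivity, ?_⟩
  intro m hm x hx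
  have hx' : 1 / 2 < x := hx
  have hx0 : 0 < x := lt_trans (by norm_num) hx'
  have : ContDiffAt ℝ m (fun x : ℝ ↦ x ^ r) x :=
    Real.contDiffAt_rpow_const <| Or.inl hx0.ne'
  rw [norm_iteratedFDerivWithin_eq_norm_iteratedDerivWithin,
    iteratedDerivWithin_eq_iteratedDeriv hunique this hx, iteratedDeriv_eq_iterate,
    Real.iter_deriv_rpow_const, norm_mul, mul_assoc]
  gcongr ?_ * ?_
  · have : m ∈ Finset.range (N + 1) := by grind
    exact Finset.single_le_sum (f := fun k => ‖Polynomial.eval r (descPochhammer ℝ k)‖)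
      (fun _ _ ↦ by positivity) this
  have hmN : (m : ℝ) ≤ N := by exact_mod_cast hm
  rw [Real.norm_of_nonneg (by positivity), Real.norm_of_nonneg hx0.le]
  rcases le_total 0 (r - m) with h | h
  · have h2 : (1:ℝ) ≤ 2 ^ (|r| + N) := Real.one_le_rpow (by norm_num) (by positivity)
    have h3 : x ^ (r - m) ≤ (1 + x) ^ k := by
      rw [← Real.rpow_natCast]
      refine (Real.rpow_le_rpow hx0.le (by linarith) h).trans
        (Real.rpow_le_rpow_of_exponent_le (by linarith) ?_)
      have : (0:ℝ) ≤ m := by positivity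
      linarith
    calc x ^ (r - m) ≤ 1 * (1 + x) ^ k := by simpa using h3
      _ ≤ _ := by gcongr
  · have h2 : (1:ℝ) ≤ (1 + x) ^ k := one_le_pow₀ (by linarith)
    have h3 : x ^ (r - m) ≤ 2 ^ (|r| + N) := by
      calc x ^ (r - m) ≤ (1/2) ^ (r - m) := Real.rpow_le_rpow_of_nonpos (by norm_num) hx'.le h
        _ = 2 ^ (-(r - m)) := by
          rw [one_div, Real.inv_rpow (by norm_num), Real.rpow_neg (by norm_num)]
        _ ≤ _ := by
          apply Real.rpow_le_rpow_of_exponent_le (by norm_num)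
          have := neg_abs_le r
          linarith
    calc x ^ (r - m) ≤ 2 ^ (|r| + N) * 1 := by simpa using h3
      _ ≤ _ := by gcongr

/-! ### Coordinates -/

/-- `xC` as a continuous linear map -/
def xL : Z n →L[ℝ] E n := LinearMap.toContinuousLinearMap
  { toFun := xC, map_add' := fun _ _ => rfl, map_smul' := fun _ _ => rfl }

/-- `vC` as a continuous linear map -/
def vL : Z n →L[ℝ] E n := LinearMap.toContinuousLinearMap
  { toFun := vC, map_add' := fun _ _ => rfl, map_smul' := fun _ _ => rfl }

/-- `tC` as a continuous linear map -/
def tL : Z n →L[ℝ] ℝ := LinearMap.toContinuousLinearMap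
  { toFun := tC, map_add' := fun _ _ => rfl, map_smul' := fun _ _ => rfl }

lemma xL_apply (ζ : Z n) : xL ζ = xC ζ := rfl
lemma vL_apply (ζ : Z n) : vL ζ = vC ζ := rfl
lemma tL_apply (ζ : Z n) : tL ζ = tC ζ := rfl

lemma xC_tg : (xC : Z n → E n).HasTemperateGrowth := (xL (n := n)).hasTemperateGrowth
lemma vC_tg : (vC : Z n → E n).HasTemperateGrowth := (vL (n := n)).hasTemperateGrowth
lemma tC_tg : (tC : Z n → ℝ).HasTemperateGrowth := (tL (n := n)).hasTemperateGrowth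
lemma coord_tg (i : Unit ⊕ Fin n ⊕ Fin n) : (fun ζ : Z n => ζ i).HasTemperateGrowth :=
  (EuclideanSpace.proj (𝕜 := ℝ) i : Z n →L[ℝ] ℝ).hasTemperateGrowth

lemma norm_sq_Z (ζ : Z n) : ‖ζ‖ ^ 2 = (tC ζ) ^ 2 + ‖xC ζ‖ ^ 2 + ‖vC ζ‖ ^ 2 := by
  simp [EuclideanSpace.norm_sq_eq, tC, xC, vC, Fintype.sum_sum_type, add_assoc]

lemma norm_xC_le (ζ : Z n) : ‖xC ζ‖ ≤ ‖ζ‖ := by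
  apply le_of_sq_le_sq _ (norm_nonneg _)
  rw [norm_sq_Z]; nlinarith [sq_nonneg (tC ζ), sq_nonneg ‖vC ζ‖]

lemma norm_vC_le (ζ : Z n) : ‖vC ζ‖ ≤ ‖ζ‖ := by
  apply le_of_sq_le_sq _ (norm_nonneg _)
  rw [norm_sq_Z]; nlinarith [sq_nonneg (tC ζ), sq_nonneg ‖xC ζ‖]

/-- unit vector in the `vᵢ` direction -/
def eV (i : Fin n) : Z n := EuclideanSpace.single (Sum.inr (Sum.inr i)) 1

/-- the vector field `(0,0,ξ)` -/
def Xi (ζ : Z n) : Z n := ∑ i, xC ζ i • eV i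

lemma tC_Xi (ζ : Z n) : tC (Xi ζ) = 0 := by
  simp [tC, Xi, eV]
lemma xC_Xi (ζ : Z n) : xC (Xi ζ) = 0 := by
  ext i; simp [xC, Xi, eV]
lemma vC_Xi (ζ : Z n) : vC (Xi ζ) = xC ζ := by
  ext i; simp [xC, vC, Xi, eV, Finset.sum_apply, Pi.single_apply]

/-! ### brackets -/

/-- `⟨ξ⟩²` -/
def jx (ζ : Z n) : ℝ := 1 + ‖xC ζ‖ ^ 2
/-- `⟨η⟩²` -/
def jv (ζ : Z n) : ℝ := 1 + ‖vC ζ‖ ^ 2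
/-- `⟨ζ⟩²` -/
def jz (ζ : Z n) : ℝ := 1 + ‖ζ‖ ^ 2

lemma one_le_jx (ζ : Z n) : 1 ≤ jx ζ := by unfold jx; nlinarith [sq_nonneg ‖xC ζ‖]
lemma one_le_jv (ζ : Z n) : 1 ≤ jv ζ := by unfold jv; nlinarith [sq_nonneg ‖vC ζ‖]
lemma one_le_jz (ζ : Z n) : 1 ≤ jz ζ := by unfold jz; nlinarith [sq_nonneg ‖ζ‖]
lemma jv_le_jz (ζ : Z n) : jv ζ ≤ jz ζ := by
  have := norm_vC_le ζ; unfold jv jz; gcongr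
lemma jx_pos (ζ : Z n) : 0 < jx ζ := by linarith [one_le_jx ζ]
lemma jv_pos (ζ : Z n) : 0 < jv ζ := by linarith [one_le_jv ζ]
lemma jz_pos (ζ : Z n) : 0 < jz ζ := by linarith [one_le_jz ζ]

lemma jx_tg : (jx : Z n → ℝ).HasTemperateGrowth := by
  have : (fun ζ : Z n => 1 + ‖xC ζ‖ ^ 2).HasTemperateGrowth :=
    (HasTemperateGrowth.const (1:ℝ)).add
      ((hasTemperateGrowth_norm_sq (H := E n)).comp xC_tg)
  exact this
lemma jv_tg : (jv : Z n → ℝ).HasTemperateGrowth := by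
  have : (fun ζ : Z n => 1 + ‖vC ζ‖ ^ 2).HasTemperateGrowth :=
    (HasTemperateGrowth.const (1:ℝ)).add
      ((hasTemperateGrowth_norm_sq (H := E n)).comp vC_tg)
  exact this
lemma jz_tg : (jz : Z n → ℝ).HasTemperateGrowth := by
  have : (fun ζ : Z n => 1 + ‖ζ‖ ^ 2).HasTemperateGrowth :=
    (HasTemperateGrowth.const (1:ℝ)).add (hasTemperateGrowth_norm_sq (H := Z n))
  exact this

lemma sqrt_one_add_sq_sub_le {V : Type*} [NormedAddCommGroup V] (x y : V) :
    |(1 + ‖x‖ ^ 2) ^ (1 / 2 : ℝ) - (1 + ‖y‖ ^ 2) ^ (1 / 2 : ℝ)| ≤ ‖x - y‖ := by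
  have key : ∀ x y : V, (1 + ‖x‖ ^ 2) ^ (1 / 2 : ℝ) - (1 + ‖y‖ ^ 2) ^ (1 / 2 : ℝ) ≤ ‖x - y‖ := by
    intro x y
    rw [← Real.sqrt_eq_rpow, ← Real.sqrt_eq_rpow, sub_le_iff_le_add]
    apply Real.sqrt_le_iff.2 ⟨by positivity, ?_⟩
    have h1 : ‖x‖ ≤ ‖x - y‖ + ‖y‖ := by simpa using norm_add_le (x - y) y
    have h2 : ‖y‖ ≤ √(1 + ‖y‖ ^ 2) := Real.le_sqrt_of_sq_le (by linarith)
    have h3 : √(1 + ‖y‖ ^ 2) ^ 2 = 1 + ‖y‖ ^ 2 := Real.sq_sqrt (by positivity)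
    have h4 : ‖x‖ ^ 2 ≤ (‖x - y‖ + ‖y‖) ^ 2 := by gcongr
    nlinarith [mul_le_mul_of_nonneg_left h2 (norm_nonneg (x - y))]
  rw [abs_le]
  have h1 := key x y
  have h2 := key y x
  rw [norm_sub_rev] at h2
  constructor <;> linarith

/-- Peetre, for reals `≥ 1` -/
lemma peetre_real {x y d : ℝ} (hx : 1 ≤ x) (hy : 1 ≤ y) (h : |x - y| ≤ d) (e : ℝ) :
    x ^ e ≤ (1 + d) ^ |e| * y ^ e := by
  have hd : 0 ≤ d := (abs_nonneg _).trans h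
  rw [abs_le] at h
  have h1 : x ≤ (1 + d) * y := by nlinarith
  have h2 : y ≤ (1 + d) * x := by nlinarith
  rcases le_total 0 e with he | he
  · rw [abs_of_nonneg he, ← Real.mul_rpow (by linarith) (by linarith)]
    exact Real.rpow_le_rpow (by linarith) h1 he
  · rw [abs_of_nonpos he]
    have h3 : ((1 + d) * x) ^ e ≤ y ^ e := Real.rpow_le_rpow_of_nonpos (by linarith) h2 he
    rw [Real.mul_rpow (by linarith) (by linarith)] at h3
    have h4 : (1 + d) ^ (-e) * (1 + d) ^ e = 1 := by
      rw [← Real.rpow_add (by linarith)]; simp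
    calc x ^ e = (1 + d) ^ (-e) * ((1 + d) ^ e * x ^ e) := by rw [← mul_assoc, h4, one_mul]
      _ ≤ _ := by gcongr

lemma diff_rpow_real {x y d : ℝ} (hx : 1 ≤ x) (hy : 1 ≤ y) (h : |x - y| ≤ d) (e : ℝ) :
    |x ^ e - y ^ e| ≤ |e| * (1 + d) ^ (|e - 1| + 1) * y ^ (e - 1) := by
  have hd : 0 ≤ d := (abs_nonneg _).trans h
  have hc : Convex ℝ (Set.uIcc y x) := convex_uIcc _ _
  have hmem : ∀ z ∈ Set.uIcc y x, 1 ≤ z ∧ |z - y| ≤ d := by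
    intro z hz
    rw [Set.mem_uIcc] at hz
    rw [abs_le] at h ⊢
    rcases hz with hz | hz <;> refine ⟨by linarith, by linarith, by linarith⟩
  have := hc.norm_image_sub_le_of_norm_hasDerivWithin_le (f := fun z : ℝ => z ^ e)
    (f' := fun z => e * z ^ (e - 1)) (C := |e| * ((1 + d) ^ |e - 1| * y ^ (e - 1)))
    (fun z hz => (Real.hasDerivAt_rpow_const
      (Or.inl (ne_of_gt (lt_of_lt_of_le one_pos (hmem z hz).1)))).hasDerivWithinAt)
    (fun z hz => by
      rw [norm_mul, Real.norm_eq_abs, Real.norm_of_nonneg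
        (Real.rpow_nonneg (by linarith [(hmem z hz).1]) _)]
      gcongr
      exact peetre_real (hmem z hz).1 hy (hmem z hz).2 _)
    Set.left_mem_uIcc Set.right_mem_uIcc
  rw [Real.norm_eq_abs, Real.norm_eq_abs] at this
  refine this.trans ?_
  rw [Real.rpow_add (by linarith), Real.rpow_one]
  have hp : 0 ≤ |e| * ((1 + d) ^ |e - 1| * y ^ (e - 1)) := by positivity
  calc _ ≤ |e| * ((1 + d) ^ |e - 1| * y ^ (e - 1)) * (1 + d) := by gcongr; linarith
    _ = _ := by ring

end Hypo
namespace Hypo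

open Function

/-! ### Young inequality -/

lemma young {k A B : Z n → ℝ} (hk : Integrable k) (hk0 : ∀ t, 0 ≤ k t)
    (hkc : Continuous k) (hAc : Continuous A) (hBc : Continuous B)
    (hA : Integrable (fun ζ => A ζ ^ 2)) (hB : Integrable (fun ζ => B ζ ^ 2))
    (Kern : Z n → Z n → ℂ) (h : ∀ ζ t, ‖Kern ζ t‖ ≤ k t * (A (ζ - t) * B ζ))
    {ε : ℝ} (hε : 0 < ε) :
    ‖∫ ζ, ∫ t, Kern ζ t‖ ≤ (∫ t, k t) / 2 * (ε * (∫ ζ, A ζ ^ 2) + ε⁻¹ * (∫ ζ, B ζ ^ 2)) := by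
  have hI1 : 0 ≤ ∫ t, k t := integral_nonneg hk0
  have hI2 : 0 ≤ (∫ ζ, A ζ ^ 2) := integral_nonneg (fun _ => sq_nonneg _)
  have hI3 : 0 ≤ (∫ ζ, B ζ ^ 2) := integral_nonneg (fun _ => sq_nonneg _)
  have hpt : ∀ ζ t, ‖Kern ζ t‖ ≤ k t * (ε / 2 * A (ζ - t) ^ 2) + k t * (ε⁻¹ / 2 * B ζ ^ 2) := by
    intro ζ t
    refine (h ζ t).trans ?_
    rw [← mul_add]
    refine mul_le_mul_of_nonneg_left ?_ (hk0 t)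
    have h1 : 0 ≤ ε⁻¹ / 2 * (ε * A (ζ - t) - B ζ) ^ 2 := by positivity
    have h2 : ε⁻¹ * ε = 1 := inv_mul_cancel₀ hε.ne'
    calc A (ζ - t) * B ζ ≤ A (ζ - t) * B ζ + ε⁻¹ / 2 * (ε * A (ζ - t) - B ζ) ^ 2 := by linarith
      _ = (ε⁻¹ * ε) * ε / 2 * A (ζ - t) ^ 2 + ε⁻¹ / 2 * B ζ ^ 2
          + A (ζ - t) * B ζ * (1 - ε⁻¹ * ε) := by ring
      _ = _ := by rw [h2]; ring
  have e1 : ∀ f : Z n → ℝ, Integrable f → (∀ x, 0 ≤ f x) →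
      ∫⁻ x, ENNReal.ofReal (f x) = ENNReal.ofReal (∫ x, f x) := fun f hf h0 =>
    (ofReal_integral_eq_lintegral_ofReal hf (Filter.Eventually.of_forall h0)).symm
  have hmk : Measurable (fun t => ENNReal.ofReal (k t)) := hkc.measurable.ennreal_ofReal
  have hmA : Measurable (fun t => ENNReal.ofReal (ε / 2 * A t ^ 2)) :=
    (by fun_prop : Continuous fun t => ε / 2 * A t ^ 2).measurable.ennreal_ofReal
  have hmB : Measurable (fun t => ENNReal.ofReal (ε⁻¹ / 2 * B t ^ 2)) :=
    (by fun_prop : Continuous fun t => ε⁻¹ / 2 * B t ^ 2).measurable.ennreal_ofReal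
  have hmAA : Measurable (Function.uncurry fun (ζ t : Z n) =>
      ENNReal.ofReal (k t) * ENNReal.ofReal (ε / 2 * A (ζ - t) ^ 2)) :=
    (hmk.comp measurable_snd).mul (hmA.comp (measurable_fst.sub measurable_snd))
  have T1 : ∫⁻ ζ : Z n, ∫⁻ t : Z n, ENNReal.ofReal (k t) * ENNReal.ofReal (ε / 2 * A (ζ - t) ^ 2)
      = ENNReal.ofReal ((∫ t, k t) * (ε / 2 * (∫ ζ, A ζ ^ 2))) := by
    rw [lintegral_lintegral_swap hmAA.aemeasurable]
    have : ∀ t : Z n, ∫⁻ ζ : Z n, ENNReal.ofReal (k t) * ENNReal.ofReal (ε / 2 * A (ζ - t) ^ 2)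
        = ENNReal.ofReal (k t) * ENNReal.ofReal (ε / 2 * (∫ ζ, A ζ ^ 2)) := by
      intro t
      have hm' : Measurable fun ζ => ENNReal.ofReal (ε / 2 * A (ζ - t) ^ 2) :=
        hmA.comp (measurable_id.sub_const t)
      rw [lintegral_const_mul _ hm',
        lintegral_sub_right_eq_self (fun ζ => ENNReal.ofReal (ε / 2 * A ζ ^ 2)) t,
        e1 _ (hA.const_mul _) (fun x => by positivity), integral_const_mul]
    simp_rw [this]
    rw [lintegral_mul_const _ hmk, e1 _ hk hk0, ENNReal.ofReal_mul hI1]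
  have T2 : ∫⁻ ζ : Z n, ∫⁻ t : Z n, ENNReal.ofReal (k t) * ENNReal.ofReal (ε⁻¹ / 2 * B ζ ^ 2)
      = ENNReal.ofReal ((∫ t, k t) * (ε⁻¹ / 2 * (∫ ζ, B ζ ^ 2))) := by
    have : ∀ ζ : Z n, ∫⁻ t : Z n, ENNReal.ofReal (k t) * ENNReal.ofReal (ε⁻¹ / 2 * B ζ ^ 2)
        = ENNReal.ofReal (∫ t, k t) * ENNReal.ofReal (ε⁻¹ / 2 * B ζ ^ 2) := by
      intro ζ
      rw [lintegral_mul_const _ hmk, e1 _ hk hk0]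
    simp_rw [this]
    rw [lintegral_const_mul _ hmB, e1 _ (hB.const_mul _) (fun x => by positivity),
      integral_const_mul, ENNReal.ofReal_mul hI1]
  have main : ‖∫ ζ, ∫ t, Kern ζ t‖ₑ ≤
      ENNReal.ofReal ((∫ t, k t) * (ε / 2 * (∫ ζ, A ζ ^ 2)))
      + ENNReal.ofReal ((∫ t, k t) * (ε⁻¹ / 2 * (∫ ζ, B ζ ^ 2))) := by
    calc ‖∫ ζ, ∫ t, Kern ζ t‖ₑ ≤ ∫⁻ ζ, ‖∫ t, Kern ζ t‖ₑ := enorm_integral_le_lintegral_enorm _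
      _ ≤ ∫⁻ ζ, ∫⁻ t, ‖Kern ζ t‖ₑ := lintegral_mono fun ζ => enorm_integral_le_lintegral_enorm _
      _ ≤ ∫⁻ ζ : Z n, ∫⁻ t : Z n, (ENNReal.ofReal (k t) * ENNReal.ofReal (ε / 2 * A (ζ - t) ^ 2)
            + ENNReal.ofReal (k t) * ENNReal.ofReal (ε⁻¹ / 2 * B ζ ^ 2)) := by
          refine lintegral_mono fun ζ => lintegral_mono fun t => ?_
          rw [← ENNReal.ofReal_mul (hk0 t), ← ENNReal.ofReal_mul (hk0 t), ← ENNReal.ofReal_add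
            (mul_nonneg (hk0 t) (by positivity)) (mul_nonneg (hk0 t) (by positivity)),
            ← ofReal_norm]
          exact ENNReal.ofReal_le_ofReal (hpt ζ t)
      _ = _ := by
          rw [← T1, ← T2, ← lintegral_add_left]
          · refine lintegral_congr fun ζ => ?_
            rw [lintegral_add_left]
            exact hmk.mul (hmA.comp (measurable_const.sub measurable_id))
          · exact hmAA.lintegral_prod_right'
  rw [← ENNReal.ofReal_add (by positivity) (by positivity), ← ofReal_norm,
    ENNReal.ofReal_le_ofReal_iff (by positivity)] at main
  refine main.trans (le_of_eq ?_)
  ring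

/-- the `L²` version of Young inequality -/
lemma young2 {k A : Z n → ℝ} (hk : Integrable k) (hk0 : ∀ t, 0 ≤ k t)
    (hkc : Continuous k) (hAc : Continuous A) (hA : Integrable (fun ζ => A ζ ^ 2))
    {f : Z n → ℂ} (hf : Continuous f) (hf2 : Integrable (fun ζ => ‖f ζ‖ ^ 2))
    (κ : Z n → Z n → ℂ) (hfk : ∀ ζ, f ζ = ∫ t, κ ζ t)
    (h : ∀ ζ t, ‖κ ζ t‖ ≤ k t * A (ζ - t)) :
    ∫ ζ, ‖f ζ‖ ^ 2 ≤ ((∫ t, k t) + 1) ^ 2 * (∫ ζ, A ζ ^ 2) := by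
  have hI1 : 0 ≤ ∫ t, k t := integral_nonneg hk0
  have hI2 : 0 ≤ (∫ ζ, A ζ ^ 2) := integral_nonneg (fun _ => sq_nonneg _)
  set c := (∫ t, k t) + 1 with hc
  have hc0 : 0 < c := by positivity
  have key := young hk hk0 hkc hAc (B := fun ζ => ‖f ζ‖) (by fun_prop) hA hf2
    (fun ζ t => κ ζ t * starRingEnd ℂ (f ζ)) (fun ζ t => by
      rw [norm_mul, RCLike.norm_conj, ← mul_assoc]
      exact mul_le_mul_of_nonneg_right (h ζ t) (norm_nonneg _)) hc0
  have e : ∫ ζ, ∫ t, κ ζ t * starRingEnd ℂ (f ζ) = ((∫ ζ, ‖f ζ‖ ^ 2 : ℝ) : ℂ) := by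
    rw [← integral_complex_ofReal]
    refine integral_congr_ae (Filter.Eventually.of_forall fun ζ => ?_)
    show ∫ t, κ ζ t * starRingEnd ℂ (f ζ) = _
    rw [integral_mul_const, ← hfk, Complex.mul_conj, Complex.normSq_eq_norm_sq]
  rw [e, Complex.norm_real, Real.norm_of_nonneg (integral_nonneg (fun _ => sq_nonneg _))] at key
  set X := ∫ ζ, ‖f ζ‖ ^ 2
  have hX : 0 ≤ X := integral_nonneg (fun _ => sq_nonneg _)
  have h2 : (∫ t, k t) / 2 * (c * (∫ ζ, A ζ ^ 2) + c⁻¹ * X)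
      ≤ c / 2 * (c * (∫ ζ, A ζ ^ 2) + c⁻¹ * X) := by
    gcongr; linarith
  have h3 : c / 2 * (c * (∫ ζ, A ζ ^ 2) + c⁻¹ * X) = (c ^ 2 * (∫ ζ, A ζ ^ 2)) / 2 + X / 2 := by
    field_simp
  linarith

/-! ### Schwartz functions -/

/-- multiplication of a Schwartz function by a real function of temperate growth -/
abbrev mu (m : Z n → ℝ) (V : 𝓢(Z n, ℂ)) : 𝓢(Z n, ℂ) := SchwartzMap.smulLeftCLM ℂ m V

lemma mu_apply {m : Z n → ℝ} (hm : m.HasTemperateGrowth) (V : 𝓢(Z n, ℂ)) (ζ : Z n) :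
    mu m V ζ = (m ζ : ℂ) * V ζ := by
  simp [mu, SchwartzMap.smulLeftCLM_apply_apply hm]

lemma norm_mu {m : Z n → ℝ} (hm : m.HasTemperateGrowth) (V : 𝓢(Z n, ℂ)) (ζ : Z n) :
    ‖mu m V ζ‖ = |m ζ| * ‖V ζ‖ := by
  simp [mu_apply hm]

lemma integrable_sq (V : 𝓢(Z n, ℂ)) : Integrable (fun ζ => ‖V ζ‖ ^ 2) :=
  (V.memLp 2).integrable_norm_pow (by norm_num)

lemma integrable_mul_norm (V V' : 𝓢(Z n, ℂ)) : Integrable (fun ζ => V ζ * starRingEnd ℂ (V' ζ)) := by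
  have h1 := V.memLp 2
  have h2 := (V'.memLp 2).star
  exact MemLp.integrable_mul h1 h2

lemma integrable_w {m : Z n → ℝ} (hm : m.HasTemperateGrowth) (V : 𝓢(Z n, ℂ)) :
    Integrable (fun ζ => m ζ * ‖V ζ‖ ^ 2) := by
  have := (integrable_mul_norm (mu m V) V).re
  refine this.congr (Filter.Eventually.of_forall fun ζ => ?_)
  show RCLike.re (mu m V ζ * starRingEnd ℂ (V ζ)) = m ζ * ‖V ζ‖ ^ 2
  rw [mu_apply hm, mul_assoc, Complex.mul_conj, Complex.normSq_eq_norm_sq]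
  norm_cast

/-- convolution of Schwartz functions -/
def conv (κ V : 𝓢(Z n, ℂ)) : 𝓢(Z n, ℂ) :=
  SchwartzMap.convolution (ContinuousLinearMap.mul ℂ ℂ) κ V

lemma conv_apply (κ V : 𝓢(Z n, ℂ)) (ζ : Z n) : conv κ V ζ = ∫ t, κ t * V (ζ - t) := by
  rw [conv, SchwartzMap.convolution_apply]
  rfl

lemma conv_integrable (κ V : 𝓢(Z n, ℂ)) (ζ : Z n) : Integrable (fun t => κ t * V (ζ - t)) := by
  obtain ⟨C, hC⟩ : ∃ C, ∀ x, ‖V x‖ ≤ C := ⟨_, fun x => SchwartzMap.norm_le_seminorm ℝ V x⟩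
  exact κ.integrable.mul_bdd (c := C)
    (by have := V.continuous; exact (by fun_prop : Continuous fun t => V (ζ - t)).aestronglyMeasurable)
    (Filter.Eventually.of_forall fun x => hC _)

lemma conv_add_left (κ κ' V : 𝓢(Z n, ℂ)) : conv (κ + κ') V = conv κ V + conv κ' V := by
  simp [conv]

lemma conv_smul_left (c : ℂ) (κ V : 𝓢(Z n, ℂ)) : conv (c • κ) V = c • conv κ V := by
  simp [conv]

lemma fourier_mul {b v h : 𝓢(Z n, ℂ)} (hh : ∀ x, h x = b x * v x) :
    𝓕 h = conv (𝓕 b) (𝓕 v) := by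
  have key : 𝓕⁻ (conv (𝓕 b) (𝓕 v)) = h := by
    ext x
    have e0 : ∀ f : 𝓢(Z n, ℂ), 𝓕⁻ f x = 𝓕 f (-x) := by
      intro f
      rw [SchwartzMap.fourierInv_coe, SchwartzMap.fourier_coe, Real.fourierInv_eq_fourier_neg]
    have e1 : ∀ f : 𝓢(Z n, ℂ), 𝓕 (𝓕 f) (-x) = f x := by
      intro f
      rw [← e0, FourierTransform.fourierInv_fourier_eq]
    rw [e0, conv, SchwartzMap.fourier_convolution, SchwartzMap.pairing_apply_apply, e1, e1, hh]
    rfl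
  rw [← key, FourierTransform.fourier_fourierInv_eq]

lemma conv_nonneg {b : 𝓢(Z n, ℂ)} {b' : Z n → ℝ} (hb : ∀ x, b x = b' x) (hb0 : ∀ x, 0 ≤ b' x)
    (V : 𝓢(Z n, ℂ)) : 0 ≤ (∫ ζ, starRingEnd ℂ (V ζ) * conv (𝓕 b) V ζ).re := by
  set v := 𝓕⁻ V with hv
  have hV : V = 𝓕 v := by rw [hv, FourierTransform.fourier_fourierInv_eq]
  set h : 𝓢(Z n, ℂ) := SchwartzMap.smulLeftCLM ℂ b v
  have hh : ∀ x, h x = b x * v x := by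
    intro x
    simp [h, SchwartzMap.smulLeftCLM_apply_apply b.hasTemperateGrowth]
  have := SchwartzMap.integral_inner_fourier_fourier v h
  rw [fourier_mul hh, ← hV] at this
  have e : ∫ ζ, starRingEnd ℂ (V ζ) * conv (𝓕 b) V ζ = ∫ ζ, inner ℂ (V ζ) (conv (𝓕 b) V ζ) := by
    congr 1; ext ζ; simp [mul_comm]
  rw [e, this]
  have e2 : ∫ x, inner ℂ (v x) (h x) = ((∫ x, b' x * ‖v x‖ ^ 2 : ℝ) : ℂ) := by
    rw [← integral_complex_ofReal]
    congr 1; ext x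
    rw [RCLike.inner_apply, hh, hb, mul_assoc, Complex.mul_conj, Complex.normSq_eq_norm_sq]
    push_cast; ring
  rw [e2, Complex.ofReal_re]
  exact integral_nonneg fun x => mul_nonneg (hb0 x) (sq_nonneg _)

/-- weights `(1+|t|)^N |κ(t)|` are integrable -/
lemma ker_integrable (κ : 𝓢(Z n, ℂ)) (N : ℕ) : Integrable (fun t => (1 + ‖t‖) ^ N * ‖κ t‖) := by
  have h : ∀ t : Z n, (1 + ‖t‖) ^ N ≤ 2 ^ N * (1 + ‖t‖ ^ N) := by
    intro t
    have := add_pow_le (zero_le_one' ℝ) (norm_nonneg t) N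
    refine this.trans ?_
    rw [one_pow]
    gcongr
    · norm_num
    · exact Nat.sub_le _ _
  have h2 : Integrable (fun t => 2 ^ N * (‖κ t‖ + ‖t‖ ^ N * ‖κ t‖)) :=
    ((κ.integrable.norm).add (κ.integrable_pow_mul volume N)).const_mul _
  have := κ.continuous
  refine h2.mono' (by fun_prop : Continuous fun t => (1 + ‖t‖) ^ N * ‖κ t‖).aestronglyMeasurable ?_
  refine Filter.Eventually.of_forall fun t => ?_
  rw [Real.norm_of_nonneg (by positivity)]
  calc _ ≤ 2 ^ N * (1 + ‖t‖ ^ N) * ‖κ t‖ := by gcongr; exact h t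
    _ = _ := by ring

end Hypo

namespace Hypo

open Function

/-! ### The transport operator on the Fourier side -/

/-- `D V = 2πiτ V - ξ⋅∂_η V` -/
def Dop (V : 𝓢(Z n, ℂ)) : 𝓢(Z n, ℂ) :=
  (2 * π * Complex.I) • mu tC V - ∑ i, mu (fun ζ => xC ζ i) (∂_{eV i} V)

lemma xCi_tg (i : Fin n) : (fun ζ : Z n => xC ζ i).HasTemperateGrowth := coord_tg _
lemma vCi_tg (i : Fin n) : (fun ζ : Z n => vC ζ i).HasTemperateGrowth := coord_tg _

lemma Dop_apply (V : 𝓢(Z n, ℂ)) (ζ : Z n) :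
    Dop V ζ = (2 * π * Complex.I) * ((tC ζ : ℂ) * V ζ) - ∑ i, (xC ζ i : ℂ) * fderiv ℝ V ζ (eV i) := by
  unfold Dop
  rw [sub_apply, smul_apply, mu_apply tC_tg, sum_apply]
  congr 1
  refine Finset.sum_congr rfl fun i _ => ?_
  rw [mu_apply (xCi_tg i), SchwartzMap.lineDerivOp_apply_eq_fderiv]

/-- the field `ξ⋅∂_η` on weights -/
def XX (m : Z n → ℝ) (ζ : Z n) : ℝ := fderiv ℝ m ζ (Xi ζ)

lemma integrable_inner (V V' : 𝓢(Z n, ℂ)) : Integrable (fun ζ => inner ℝ (V ζ) (V' ζ)) := by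
  have := (integrable_mul_norm V' V).re
  refine this.congr (Filter.Eventually.of_forall fun ζ => ?_)
  simp [Complex.inner]

lemma inner_ofReal_mul_left (c : ℝ) (z w : ℂ) : inner ℝ ((c : ℂ) * z) w = c * inner ℝ z w := by
  rw [← Complex.real_smul, real_inner_smul_left]
lemma inner_ofReal_mul_right (c : ℝ) (z w : ℂ) : inner ℝ z ((c : ℂ) * w) = c * inner ℝ z w := by
  rw [← Complex.real_smul, real_inner_smul_right]

lemma ibp_aux {c : Z n → ℝ} (hc : c.HasTemperateGrowth) (W : 𝓢(Z n, ℂ)) (e : Z n) :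
    Integrable (fun ζ => fderiv ℝ c ζ e * ‖W ζ‖ ^ 2) ∧
    ∫ ζ, inner ℝ (mu c W ζ) ((∂_{e} W) ζ) = - (1 / 2) * ∫ ζ, fderiv ℝ c ζ e * ‖W ζ‖ ^ 2 := by
  have hd : ∀ ζ, (∂_{e} (mu c W)) ζ = (c ζ : ℂ) * (∂_{e} W) ζ + (fderiv ℝ c ζ e : ℂ) * W ζ := by
    intro ζ
    have h1 : DifferentiableAt ℝ c ζ := (hc.1.differentiable (by simp)) ζ
    have h2 : DifferentiableAt ℝ (W : Z n → ℂ) ζ := W.differentiableAt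
    have h3 : (mu c W : Z n → ℂ) = fun ζ => c ζ • W ζ := by
      funext ζ; rw [mu_apply hc]; simp
    rw [SchwartzMap.lineDerivOp_apply_eq_fderiv, h3, fderiv_fun_smul h1 h2,
      SchwartzMap.lineDerivOp_apply_eq_fderiv]
    simp
  have hpt : ∀ ζ, fderiv ℝ c ζ e * ‖W ζ‖ ^ 2 =
      inner ℝ ((∂_{e} (mu c W)) ζ) (W ζ) - inner ℝ ((∂_{e} W) ζ) (mu c W ζ) := by
    intro ζ
    rw [hd, inner_add_left, inner_ofReal_mul_left, inner_ofReal_mul_left, mu_apply hc,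
      inner_ofReal_mul_right, real_inner_self_eq_norm_sq]
    ring
  have i1 := integrable_inner (∂_{e} (mu c W)) W
  have i2 := integrable_inner (∂_{e} W) (mu c W)
  have hIntg : Integrable (fun ζ => fderiv ℝ c ζ e * ‖W ζ‖ ^ 2) :=
    (i1.sub i2).congr (Filter.Eventually.of_forall fun ζ => (hpt ζ).symm)
  refine ⟨hIntg, ?_⟩
  have key : ∫ ζ, inner ℝ (mu c W ζ) ((∂_{e} W) ζ) = - ∫ ζ, inner ℝ ((∂_{e} (mu c W)) ζ) (W ζ) :=
    SchwartzMap.integral_bilinear_lineDerivOp_right_eq_neg_left (μ := volume)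
    (mu c W) W (innerSL ℝ) e
  have e2 : ∫ ζ, fderiv ℝ c ζ e * ‖W ζ‖ ^ 2 = (∫ ζ, inner ℝ ((∂_{e} (mu c W)) ζ) (W ζ))
      - ∫ ζ, inner ℝ ((∂_{e} W) ζ) (mu c W ζ) := by
    rw [← integral_sub i1 i2]; exact integral_congr_ae (Filter.Eventually.of_forall hpt)
  have e3 : ∫ ζ, inner ℝ ((∂_{e} W) ζ) (mu c W ζ) = ∫ ζ, inner ℝ (mu c W ζ) ((∂_{e} W) ζ) := by
    congr 1; ext ζ; rw [real_inner_comm]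
  rw [e2, e3]
  linarith

lemma ibp {m : Z n → ℝ} (hm : m.HasTemperateGrowth) (W : 𝓢(Z n, ℂ)) :
    Integrable (fun ζ => XX m ζ * ‖W ζ‖ ^ 2) ∧
    ∫ ζ, inner ℝ (mu m W ζ) (Dop W ζ) = (1 / 2) * ∫ ζ, XX m ζ * ‖W ζ‖ ^ 2 := by
  have hc : ∀ i, (fun ζ => m ζ * xC ζ i).HasTemperateGrowth := fun i => hm.mul (xCi_tg i)
  have hfd : ∀ i ζ, fderiv ℝ (fun ζ => m ζ * xC ζ i) ζ (eV i) = xC ζ i * fderiv ℝ m ζ (eV i) := by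
    intro i ζ
    have h1 : DifferentiableAt ℝ m ζ := (hm.1.differentiable (by simp)) ζ
    have h2 : HasFDerivAt (fun ζ : Z n => xC ζ i)
      (EuclideanSpace.proj (𝕜 := ℝ) (Sum.inr (Sum.inl i)) : Z n →L[ℝ] ℝ) ζ :=
      (EuclideanSpace.proj (𝕜 := ℝ) (Sum.inr (Sum.inl i)) : Z n →L[ℝ] ℝ).hasFDerivAt
    rw [(h1.hasFDerivAt.fun_mul h2).fderiv]
    simp [eV]
  have hX : ∀ ζ, XX m ζ * ‖W ζ‖ ^ 2 =
      ∑ i, fderiv ℝ (fun ζ => m ζ * xC ζ i) ζ (eV i) * ‖W ζ‖ ^ 2 := by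
    intro ζ
    rw [← Finset.sum_mul]
    congr 1
    simp_rw [hfd, XX, Xi, map_sum, map_smul, smul_eq_mul]
  have hIntg : Integrable (fun ζ => XX m ζ * ‖W ζ‖ ^ 2) := by
    refine (integrable_finsetSum Finset.univ fun i _ => (ibp_aux (hc i) W (eV i)).1).congr
      (Filter.Eventually.of_forall fun ζ => (hX ζ).symm)
  refine ⟨hIntg, ?_⟩
  have hpt : ∀ ζ, inner ℝ (mu m W ζ) (Dop W ζ) =
      - ∑ i, inner ℝ (mu (fun ζ => m ζ * xC ζ i) W ζ) ((∂_{eV i} W) ζ) := by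
    intro ζ
    rw [Dop_apply, inner_sub_right, inner_sum]
    have : inner ℝ (mu m W ζ) (2 * π * Complex.I * ((tC ζ : ℂ) * W ζ)) = 0 := by
      rw [mu_apply hm, inner_ofReal_mul_left]
      simp [Complex.inner]
      right; ring
    rw [this, zero_sub]
    congr 1
    refine Finset.sum_congr rfl fun i _ => ?_
    rw [mu_apply hm, mu_apply (hc i), SchwartzMap.lineDerivOp_apply_eq_fderiv,
      inner_ofReal_mul_right, inner_ofReal_mul_left, inner_ofReal_mul_left]
    ring
  rw [integral_congr_ae (Filter.Eventually.of_forall hpt), integral_neg,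
    integral_finsetSum _ (fun i _ => integrable_inner _ _),
    integral_congr_ae (Filter.Eventually.of_forall hX),
    integral_finsetSum _ (fun i _ => (ibp_aux (hc i) W (eV i)).1), ← Finset.sum_neg_distrib,
    Finset.mul_sum]
  refine Finset.sum_congr rfl fun i _ => ?_
  rw [(ibp_aux (hc i) W (eV i)).2]
  ring

lemma hasDerivAt_line {m : Z n → ℝ} (hm : m.HasTemperateGrowth) {ζ : Z n} {d : ℝ}
    (h : HasDerivAt (fun h : ℝ => m (ζ + h • Xi ζ)) d 0) : XX m ζ = d := by
  have h1 : HasFDerivAt m (fderiv ℝ m ζ) ζ := ((hm.1.differentiable (by simp)) ζ).hasFDerivAt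
  have h2 : HasDerivAt (fun h : ℝ => ζ + h • Xi ζ) (Xi ζ) 0 := by
    simpa using ((hasDerivAt_id (0:ℝ)).smul_const (Xi ζ)).const_add ζ
  have h3 : HasFDerivAt m (fderiv ℝ m ζ) (ζ + (0:ℝ) • Xi ζ) := by simpa using h1
  exact (h3.comp_hasDerivAt (0:ℝ) h2).unique h

lemma xC_line (ζ : Z n) (h : ℝ) : xC (ζ + h • Xi ζ) = xC ζ := by
  rw [← xL_apply, map_add, map_smul, xL_apply, xL_apply, xC_Xi]; simp
lemma vC_line (ζ : Z n) (h : ℝ) : vC (ζ + h • Xi ζ) = vC ζ + h • xC ζ := by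
  rw [← vL_apply, map_add, map_smul, vL_apply, vL_apply, vC_Xi]
lemma jx_line (ζ : Z n) (h : ℝ) : jx (ζ + h • Xi ζ) = jx ζ := by
  rw [jx, jx, xC_line]
lemma jv_line (ζ : Z n) (h : ℝ) : jv (ζ + h • Xi ζ) =
    jv ζ + 2 * h * inner ℝ (vC ζ) (xC ζ) + h ^ 2 * ‖xC ζ‖ ^ 2 := by
  rw [jv, jv, vC_line, norm_add_sq_real, real_inner_smul_right, norm_smul, mul_pow,
    Real.norm_eq_abs, sq_abs]
  ring
lemma tC_line (ζ : Z n) (h : ℝ) : tC (ζ + h • Xi ζ) = tC ζ := by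
  rw [← tL_apply, map_add, map_smul, tL_apply, tL_apply, tC_Xi]; simp
lemma jz_line (ζ : Z n) (h : ℝ) : jz (ζ + h • Xi ζ) =
    jz ζ + 2 * h * inner ℝ (vC ζ) (xC ζ) + h ^ 2 * ‖xC ζ‖ ^ 2 := by
  have := jv_line ζ h
  unfold jv at this
  rw [jz, jz, norm_sq_Z, norm_sq_Z, tC_line, xC_line]
  linarith

lemma hasDerivAt_jv (ζ : Z n) :
    HasDerivAt (fun h : ℝ => jv (ζ + h • Xi ζ)) (2 * inner ℝ (vC ζ) (xC ζ)) 0 := by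
  simp_rw [jv_line]
  have h1 := ((hasDerivAt_id (0:ℝ)).const_mul 2).mul_const (inner ℝ (vC ζ) (xC ζ) : ℝ)
  have h2 := (((hasDerivAt_id (0:ℝ)).pow 2).mul_const (‖xC ζ‖ ^ 2))
  simpa using (h1.const_add (jv ζ)).fun_add h2

lemma hasDerivAt_jz (ζ : Z n) :
    HasDerivAt (fun h : ℝ => jz (ζ + h • Xi ζ)) (2 * inner ℝ (vC ζ) (xC ζ)) 0 := by
  simp_rw [jz_line]
  have h1 := ((hasDerivAt_id (0:ℝ)).const_mul 2).mul_const (inner ℝ (vC ζ) (xC ζ) : ℝ)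
  have h2 := (((hasDerivAt_id (0:ℝ)).pow 2).mul_const (‖xC ζ‖ ^ 2))
  simpa using (h1.const_add (jz ζ)).fun_add h2

end Hypo

namespace Hypo

open Function

/-! ### The weights -/

/-- `α = 1/(2σ+1)` -/
def al (σ : ℝ) : ℝ := 1 / (2 * σ + 1)

/-- `⟨η⟩^{2σ}` -/
def lam (σ : ℝ) (ζ : Z n) : ℝ := jv ζ ^ σ
/-- `⟨η⟩^{σ}` -/
def lh (σ : ℝ) (ζ : Z n) : ℝ := jv ζ ^ (σ / 2)
/-- `⟨ξ⟩^{2σ/(2σ+1)}` -/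
def rr (σ : ℝ) (ζ : Z n) : ℝ := jx ζ ^ (σ * al σ)
/-- `⟨ξ⟩^{σ/(2σ+1)}` -/
def rh (σ : ℝ) (ζ : Z n) : ℝ := jx ζ ^ (σ * al σ / 2)
/-- `⟨η⟩² + ⟨ξ⟩^{2/(2σ+1)}` -/
def TT (σ : ℝ) (ζ : Z n) : ℝ := jv ζ + jx ζ ^ al σ
/-- `TT^σ` -/
def GG (σ : ℝ) (ζ : Z n) : ℝ := TT σ ζ ^ σ
/-- the subelliptic multiplier -/
def psi (σ : ℝ) (ζ : Z n) : ℝ := inner ℝ (vC ζ) (xC ζ) * jx ζ ^ (- al σ / 2) * TT σ ζ ^ (-1 / 2 : ℝ)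
/-- `lh * rh` -/
def qq (σ : ℝ) (ζ : Z n) : ℝ := lh σ ζ * rh σ ζ

section
variable {σ : ℝ}

lemma al_pos (hσ : 0 < σ) : 0 < al σ := by unfold al; positivity
lemma al_lt (hσ : 0 < σ) : al σ < 1 := by
  unfold al; rw [div_lt_one (by positivity)]; linarith
lemma al_eq (hσ : 0 < σ) : 1 - al σ = 2 * (σ * al σ) := by
  unfold al; field_simp; ring

lemma one_le_TT (σ : ℝ) (ζ : Z n) : 1 ≤ TT σ ζ := by
  have h1 := one_le_jv ζ
  have h2 : 0 ≤ jx ζ ^ al σ := Real.rpow_nonneg (jx_pos ζ).le _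
  unfold TT; linarith
lemma TT_pos (σ : ℝ) (ζ : Z n) : 0 < TT σ ζ := by linarith [one_le_TT σ ζ]

lemma one_le_lam (hσ : 0 < σ) (ζ : Z n) : 1 ≤ lam σ ζ := Real.one_le_rpow (one_le_jv ζ) hσ.le
lemma one_le_lh (hσ : 0 < σ) (ζ : Z n) : 1 ≤ lh σ ζ :=
  Real.one_le_rpow (one_le_jv ζ) (by positivity)
lemma one_le_rr (hσ : 0 < σ) (ζ : Z n) : 1 ≤ rr σ ζ :=
  Real.one_le_rpow (one_le_jx ζ) (mul_pos hσ (al_pos hσ)).le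
lemma one_le_rh (hσ : 0 < σ) (ζ : Z n) : 1 ≤ rh σ ζ :=
  Real.one_le_rpow (one_le_jx ζ) (by have := mul_pos hσ (al_pos hσ); positivity)

lemma lh_sq (σ : ℝ) (ζ : Z n) : lh σ ζ ^ 2 = lam σ ζ := by
  unfold lh lam
  rw [← Real.rpow_natCast, ← Real.rpow_mul (jv_pos ζ).le]; norm_num
lemma rh_sq (σ : ℝ) (ζ : Z n) : rh σ ζ ^ 2 = rr σ ζ := by
  unfold rh rr
  rw [← Real.rpow_natCast, ← Real.rpow_mul (jx_pos ζ).le]; norm_num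
lemma qq_sq (σ : ℝ) (ζ : Z n) : qq σ ζ ^ 2 = lam σ ζ * rr σ ζ := by
  unfold qq; rw [mul_pow, lh_sq, rh_sq]

lemma lam_tg (σ : ℝ) : (lam σ : Z n → ℝ).HasTemperateGrowth := tg_rpow jv_tg one_le_jv _
lemma lh_tg (σ : ℝ) : (lh σ : Z n → ℝ).HasTemperateGrowth := tg_rpow jv_tg one_le_jv _
lemma rr_tg (σ : ℝ) : (rr σ : Z n → ℝ).HasTemperateGrowth := tg_rpow jx_tg one_le_jx _
lemma rh_tg (σ : ℝ) : (rh σ : Z n → ℝ).HasTemperateGrowth := tg_rpow jx_tg one_le_jx _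
lemma qq_tg (σ : ℝ) : (qq σ : Z n → ℝ).HasTemperateGrowth := (lh_tg σ).mul (rh_tg σ)
lemma TT_tg (σ : ℝ) : (TT σ : Z n → ℝ).HasTemperateGrowth :=
  jv_tg.add (tg_rpow jx_tg one_le_jx _)
lemma GG_tg (σ : ℝ) : (GG σ : Z n → ℝ).HasTemperateGrowth := tg_rpow (TT_tg σ) (one_le_TT σ) _
lemma inner_tg : (fun ζ : Z n => inner ℝ (vC ζ) (xC ζ)).HasTemperateGrowth := by
  have : (fun ζ : Z n => inner ℝ (vC ζ) (xC ζ)) = fun ζ => ∑ i, vC ζ i * xC ζ i := by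
    funext ζ; simp [PiLp.inner_apply, mul_comm]
  rw [this]
  exact HasTemperateGrowth.sum fun i _ => (vCi_tg i).mul (xCi_tg i)
lemma psi_tg (σ : ℝ) : (psi σ : Z n → ℝ).HasTemperateGrowth :=
  (inner_tg.mul (tg_rpow jx_tg one_le_jx _)).mul (tg_rpow (TT_tg σ) (one_le_TT σ) _)

/-! ### Differences -/

lemma jv_half_diff (ζ t : Z n) : |jv ζ ^ (1/2:ℝ) - jv (ζ - t) ^ (1/2:ℝ)| ≤ ‖t‖ := by
  refine (sqrt_one_add_sq_sub_le (vC ζ) (vC (ζ - t))).trans ?_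
  rw [← vL_apply, ← vL_apply, ← map_sub, vL_apply, sub_sub_cancel]
  exact norm_vC_le t
lemma jx_half_diff (ζ t : Z n) : |jx ζ ^ (1/2:ℝ) - jx (ζ - t) ^ (1/2:ℝ)| ≤ ‖t‖ := by
  refine (sqrt_one_add_sq_sub_le (xC ζ) (xC (ζ - t))).trans ?_
  rw [← xL_apply, ← xL_apply, ← map_sub, xL_apply, sub_sub_cancel]
  exact norm_xC_le t
lemma jz_half_diff (ζ t : Z n) : |jz ζ ^ (1/2:ℝ) - jz (ζ - t) ^ (1/2:ℝ)| ≤ ‖t‖ := by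
  refine (sqrt_one_add_sq_sub_le ζ (ζ - t)).trans ?_
  rw [sub_sub_cancel]

lemma diff_small {x y d e : ℝ} (hx : 1 ≤ x) (hy : 1 ≤ y) (h : |x - y| ≤ d) (he : 0 ≤ e) (he1 : e ≤ 1) :
    |x ^ e - y ^ e| ≤ (1 + d) ^ 2 := by
  have hd : 0 ≤ d := (abs_nonneg _).trans h
  refine (diff_rpow_real hx hy h e).trans ?_
  have h1 : (1 + d) ^ (|e - 1| + 1) ≤ (1 + d) ^ 2 := by
    rw [← Real.rpow_natCast]
    apply Real.rpow_le_rpow_of_exponent_le (by linarith)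
    rw [abs_of_nonpos (by linarith)]; push_cast; linarith
  have h2 : y ^ (e - 1) ≤ 1 := Real.rpow_le_one_of_one_le_of_nonpos hy (by linarith)
  have h3 : 0 ≤ y ^ (e - 1) := Real.rpow_nonneg (by linarith) _
  rw [abs_of_nonneg he]
  calc e * (1 + d) ^ (|e - 1| + 1) * y ^ (e - 1) ≤ 1 * (1 + d) ^ 2 * 1 := by gcongr
    _ = _ := by ring

lemma half_rpow {x : ℝ} (hx : 1 ≤ x) (e : ℝ) : (x ^ (1/2:ℝ)) ^ e = x ^ (e / 2) := by
  rw [← Real.rpow_mul (by linarith)]; congr 1; ring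

lemma one_le_half {x : ℝ} (hx : 1 ≤ x) : 1 ≤ x ^ (1/2:ℝ) := Real.one_le_rpow hx (by norm_num)

lemma lh_diff (hσ : 0 < σ) (hσ1 : σ < 1) (ζ t : Z n) : |lh σ ζ - lh σ (ζ - t)| ≤ (1 + ‖t‖) ^ 2 := by
  have := diff_small (one_le_half (one_le_jv ζ)) (one_le_half (one_le_jv (ζ - t)))
    (jv_half_diff ζ t) hσ.le hσ1.le
  rwa [half_rpow (one_le_jv _), half_rpow (one_le_jv _)] at this

lemma rh_diff (hσ : 0 < σ) (hσ1 : σ < 1) (ζ t : Z n) : |rh σ ζ - rh σ (ζ - t)| ≤ (1 + ‖t‖) ^ 2 := by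
  have h1 := al_pos hσ
  have h2 := al_lt hσ
  have := diff_small (e := σ * al σ) (one_le_half (one_le_jx ζ)) (one_le_half (one_le_jx (ζ - t)))
    (jx_half_diff ζ t) (by positivity) (by nlinarith)
  rwa [half_rpow (one_le_jx _), half_rpow (one_le_jx _)] at this

lemma ker_r (hσ : 0 < σ) (hσ1 : σ < 1) (ζ t : Z n) :
    |rr σ ζ * lam σ (ζ - t) - qq σ ζ * qq σ (ζ - t)|
      ≤ (1 + ‖t‖) ^ 2 * (lh σ (ζ - t) * (rr σ ζ + qq σ ζ)) := by
  have h1 := abs_le.1 (lh_diff hσ hσ1 ζ t)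
  have h2 := abs_le.1 (rh_diff hσ hσ1 ζ t)
  have a1 := one_le_lh hσ ζ
  have a2 := one_le_lh hσ (ζ - t)
  have a3 := one_le_rh hσ ζ
  rw [← rh_sq, ← lh_sq]
  unfold qq
  set l := lh σ ζ
  set l' := lh σ (ζ - t)
  set p := rh σ ζ
  set p' := rh σ (ζ - t)
  set d := (1 + ‖t‖) ^ 2
  have e1 : p ^ 2 * l' ^ 2 - l * p * (l' * p') = (l' * p) * ((l' - l) * p + l * (p - p')) := by ring
  rw [e1, abs_mul, abs_of_nonneg (by positivity)]
  have e2 : |(l' - l) * p + l * (p - p')| ≤ d * (p + l) := by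
    rw [abs_le]
    constructor <;> nlinarith
  calc _ ≤ l' * p * (d * (p + l)) := by gcongr
    _ = _ := by ring

lemma lh_le_qq (hσ : 0 < σ) (ζ : Z n) : lh σ ζ ≤ qq σ ζ := by
  unfold qq
  have h1 := one_le_lh hσ ζ
  have h2 := one_le_rh hσ ζ
  nlinarith

lemma ker_psi (hσ : 0 < σ) (hσ1 : σ < 1) (ζ t : Z n) :
    rr σ ζ * lam σ (ζ - t)
      ≤ (1 + ‖t‖) ^ 2 * (qq σ (ζ - t) * (rr σ ζ + 2 * qq σ ζ)) := by
  have h := abs_le.1 (ker_r hσ hσ1 ζ t)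
  have h1 := lh_le_qq hσ (ζ - t)
  have a1 := one_le_lh hσ ζ
  have a2 := one_le_rr hσ ζ
  have a3 := (one_le_lh hσ (ζ-t)).trans (lh_le_qq hσ (ζ-t))
  have a4 := (one_le_lh hσ ζ).trans (lh_le_qq hσ ζ)
  have h2 : (1:ℝ) ≤ (1 + ‖t‖) ^ 2 := one_le_pow₀ (by linarith [norm_nonneg t])
  set d := (1 + ‖t‖) ^ 2
  have h3 : d * (lh σ (ζ - t) * (rr σ ζ + qq σ ζ)) ≤ d * (qq σ (ζ - t) * (rr σ ζ + qq σ ζ)) := by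
    gcongr
  have h4 : qq σ ζ * qq σ (ζ - t) ≤ d * (qq σ ζ * qq σ (ζ - t)) :=
    le_mul_of_one_le_left (by positivity) h2
  nlinarith [h.2]

/-! ### Derivatives -/

lemma lam_le_GG (hσ : 0 < σ) (ζ : Z n) : lam σ ζ ≤ GG σ ζ := by
  unfold lam GG TT
  have := Real.rpow_nonneg (jx_pos ζ).le (al σ)
  exact Real.rpow_le_rpow (jv_pos ζ).le (by linarith) hσ.le

lemma GG_le (hσ : 0 < σ) (hσ1 : σ < 1) (ζ : Z n) : GG σ ζ ≤ lam σ ζ + rr σ ζ := by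
  unfold lam GG TT rr
  refine (Real.rpow_add_le_add_rpow (jv_pos ζ).le (Real.rpow_nonneg (jx_pos ζ).le _)
    hσ.le hσ1.le).trans ?_
  rw [← Real.rpow_mul (jx_pos ζ).le, mul_comm (al σ)]

lemma inner_bound (hσ : 0 < σ) (ζ : Z n) :
    |inner ℝ (vC ζ) (xC ζ)| ≤ TT σ ζ ^ (1/2:ℝ) * jx ζ ^ (1/2:ℝ) := by
  refine (abs_real_inner_le_norm _ _).trans ?_
  have := Real.rpow_nonneg (jx_pos ζ).le (al σ)
  rw [← Real.sqrt_eq_rpow, ← Real.sqrt_eq_rpow]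
  gcongr
  · apply Real.le_sqrt_of_sq_le; unfold TT jv; linarith
  · apply Real.le_sqrt_of_sq_le; unfold jx; linarith

lemma TT_neg_half (hσ : 0 < σ) (ζ : Z n) : TT σ ζ ^ (-1/2:ℝ) ≤ jx ζ ^ (- al σ / 2) := by
  have h1 : jx ζ ^ (al σ) ≤ TT σ ζ := by unfold TT; linarith [jv_pos ζ]
  have h2 := Real.rpow_le_rpow_of_nonpos (Real.rpow_pos_of_pos (jx_pos ζ) _) h1
    (show (-1/2:ℝ) ≤ 0 by norm_num)
  refine h2.trans (le_of_eq ?_)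
  rw [← Real.rpow_mul (jx_pos ζ).le]; congr 1; ring

lemma rr_eq (hσ : 0 < σ) (ζ : Z n) : jx ζ ^ (1/2:ℝ) * jx ζ ^ (- al σ / 2) = rr σ ζ := by
  unfold rr
  rw [← Real.rpow_add (jx_pos ζ)]; congr 1; linarith [al_eq hσ]

lemma psi_le (hσ : 0 < σ) (ζ : Z n) : |psi σ ζ| ≤ rr σ ζ := by
  unfold psi
  have h0 : 0 ≤ jx ζ ^ (- al σ / 2) := Real.rpow_nonneg (jx_pos ζ).le _
  have h1 : 0 ≤ TT σ ζ ^ (-1/2:ℝ) := Real.rpow_nonneg (TT_pos σ ζ).le _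
  rw [abs_mul, abs_mul, abs_of_nonneg h0, abs_of_nonneg h1]
  have h2 : TT σ ζ ^ (1/2:ℝ) * TT σ ζ ^ (-1/2:ℝ) = 1 := by
    rw [← Real.rpow_add (TT_pos σ ζ)]; norm_num
  calc _ ≤ (TT σ ζ ^ (1/2:ℝ) * jx ζ ^ (1/2:ℝ)) * jx ζ ^ (- al σ / 2) * TT σ ζ ^ (-1/2:ℝ) := by
        gcongr; exact inner_bound hσ ζ
    _ = (TT σ ζ ^ (1/2:ℝ) * TT σ ζ ^ (-1/2:ℝ)) * (jx ζ ^ (1/2:ℝ) * jx ζ ^ (- al σ / 2)) := by ring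
    _ = _ := by rw [h2, rr_eq hσ, one_mul]

lemma XX_rr (σ : ℝ) (ζ : Z n) : XX (rr σ) ζ = 0 := by
  apply hasDerivAt_line (rr_tg σ)
  simp_rw [rr, jx_line]
  exact hasDerivAt_const _ _

lemma hasDerivAt_TT (σ : ℝ) (ζ : Z n) :
    HasDerivAt (fun h : ℝ => TT σ (ζ + h • Xi ζ)) (2 * inner ℝ (vC ζ) (xC ζ)) 0 := by
  simp_rw [TT, jx_line]
  exact (hasDerivAt_jv ζ).add_const _

lemma hasDerivAt_TT_pow (σ : ℝ) (ζ : Z n) (e : ℝ) :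
    HasDerivAt (fun h : ℝ => TT σ (ζ + h • Xi ζ) ^ e)
      (2 * inner ℝ (vC ζ) (xC ζ) * e * TT σ ζ ^ (e - 1)) 0 := by
  have := (hasDerivAt_TT σ ζ).rpow_const (p := e)
    (Or.inl (by simpa using (TT_pos σ ζ).ne'))
  simpa using this

lemma XX_GG (hσ : 0 < σ) (hσ1 : σ < 1) (ζ : Z n) :
    |XX (GG σ) ζ| ≤ 2 * (rr σ ζ * lam σ ζ + rr σ ζ ^ 2) := by
  rw [hasDerivAt_line (GG_tg σ) (hasDerivAt_TT_pow σ ζ σ)]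
  have h1 : 0 ≤ TT σ ζ ^ (σ - 1) := Real.rpow_nonneg (TT_pos σ ζ).le _
  rw [abs_mul, abs_mul, abs_mul, abs_of_nonneg h1, abs_of_nonneg hσ.le, abs_two]
  have h2 : TT σ ζ ^ (1/2:ℝ) * TT σ ζ ^ (σ - 1) = GG σ ζ * TT σ ζ ^ (-1/2:ℝ) := by
    unfold GG
    rw [← Real.rpow_add (TT_pos σ ζ), ← Real.rpow_add (TT_pos σ ζ)]; congr 1; ring
  have h4 := one_le_rr hσ ζ
  have h5 := one_le_lam hσ ζ
  have h6 := lam_le_GG hσ ζ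
  have h3 : |inner ℝ (vC ζ) (xC ζ)| * TT σ ζ ^ (σ - 1) ≤ rr σ ζ * (lam σ ζ + rr σ ζ) := by
    have g0 : 0 ≤ jx ζ ^ (1/2:ℝ) := Real.rpow_nonneg (jx_pos ζ).le _
    calc _ ≤ (TT σ ζ ^ (1/2:ℝ) * jx ζ ^ (1/2:ℝ)) * TT σ ζ ^ (σ - 1) := by
          gcongr; exact inner_bound hσ ζ
      _ = (TT σ ζ ^ (1/2:ℝ) * TT σ ζ ^ (σ - 1)) * jx ζ ^ (1/2:ℝ) := by ring
      _ = GG σ ζ * (jx ζ ^ (1/2:ℝ) * TT σ ζ ^ (-1/2:ℝ)) := by rw [h2]; ring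
      _ ≤ GG σ ζ * (jx ζ ^ (1/2:ℝ) * jx ζ ^ (- al σ / 2)) := by
          have : 0 ≤ GG σ ζ := by linarith
          gcongr; exact TT_neg_half hσ ζ
      _ = rr σ ζ * GG σ ζ := by rw [rr_eq hσ]; ring
      _ ≤ _ := by gcongr; exact GG_le hσ hσ1 ζ
  have h7 : 0 ≤ |inner ℝ (vC ζ) (xC ζ)| * TT σ ζ ^ (σ - 1) := by positivity
  nlinarith

lemma XX_psi (σ : ℝ) (ζ : Z n) :
    XX (psi σ) ζ = jx ζ ^ (- al σ / 2) * TT σ ζ ^ (-3/2:ℝ) *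
      (‖xC ζ‖ ^ 2 * TT σ ζ - inner ℝ (vC ζ) (xC ζ) ^ 2) := by
  have h1 : HasDerivAt (fun h : ℝ => inner ℝ (vC (ζ + h • Xi ζ)) (xC (ζ + h • Xi ζ)))
      (‖xC ζ‖ ^ 2) 0 := by
    simp_rw [vC_line, xC_line, inner_add_left, real_inner_smul_left, real_inner_self_eq_norm_sq]
    simpa using ((hasDerivAt_id (0:ℝ)).mul_const (‖xC ζ‖ ^ 2)).const_add (inner ℝ (vC ζ) (xC ζ))
  have h2 := (h1.mul_const (jx ζ ^ (- al σ / 2))).fun_mul (hasDerivAt_TT_pow σ ζ (-1/2))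
  have h3 : (fun h : ℝ => psi σ (ζ + h • Xi ζ)) = fun h : ℝ =>
      inner ℝ (vC (ζ + h • Xi ζ)) (xC (ζ + h • Xi ζ)) * jx ζ ^ (-al σ / 2) *
        TT σ (ζ + h • Xi ζ) ^ (-1 / 2 : ℝ) := by
    funext h; rw [psi, jx_line]
  rw [← h3] at h2
  rw [hasDerivAt_line (psi_tg σ) h2]
  have e1 : TT σ ζ ^ (-1/2:ℝ) = TT σ ζ ^ (-3/2:ℝ) * TT σ ζ := by
    nth_rewrite 3 [← Real.rpow_one (TT σ ζ)]
    rw [← Real.rpow_add (TT_pos σ ζ)]; norm_num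
  have e2 : (-1/2 - 1 : ℝ) = -3/2 := by norm_num
  simp only [zero_smul, add_zero, e2, e1]
  ring

lemma XX_psi_ge (hσ : 0 < σ) (ζ : Z n) :
    rr σ ζ ^ 2 ≤ 8 * XX (psi σ) ζ + lam σ ζ * rr σ ζ + 4 := by
  have hj := one_le_jx ζ
  have hj0 := jx_pos ζ
  have hT0 := TT_pos σ ζ
  have hr := one_le_rr hσ ζ
  have hl := one_le_lam hσ ζ
  have hI : inner ℝ (vC ζ) (xC ζ) ^ 2 ≤ ‖vC ζ‖ ^ 2 * ‖xC ζ‖ ^ 2 := by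
    have := abs_real_inner_le_norm (vC ζ) (xC ζ)
    rw [← mul_pow, ← sq_abs]; gcongr
  have hb : 0 ≤ jx ζ ^ al σ := Real.rpow_nonneg hj0.le _
  have hlow : jx ζ ^ (al σ / 2) * TT σ ζ ^ (-3/2:ℝ) * ‖xC ζ‖ ^ 2 ≤ XX (psi σ) ζ := by
    rw [XX_psi]
    have e1 : jx ζ ^ (al σ / 2) = jx ζ ^ (- al σ / 2) * jx ζ ^ al σ := by
      rw [← Real.rpow_add hj0]; congr 1; ring
    rw [e1]
    have e2 : jx ζ ^ al σ * ‖xC ζ‖ ^ 2 ≤ ‖xC ζ‖ ^ 2 * TT σ ζ - inner ℝ (vC ζ) (xC ζ) ^ 2 := by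
      unfold TT jv; nlinarith [sq_nonneg ‖xC ζ‖]
    have g1 : 0 ≤ jx ζ ^ (- al σ / 2) * TT σ ζ ^ (-3/2:ℝ) := by positivity
    nlinarith [mul_le_mul_of_nonneg_left e2 g1]
  have hnn : 0 ≤ XX (psi σ) ζ := le_trans (by positivity) hlow
  rcases lt_or_ge ‖xC ζ‖ 1 with h | h
  · have h1 : jx ζ ≤ 2 := by unfold jx; nlinarith [norm_nonneg (xC ζ)]
    have h2 : rr σ ζ ≤ 2 := by
      unfold rr
      have := al_eq hσ
      have h3 := al_pos hσ
      calc jx ζ ^ (σ * al σ) ≤ jx ζ ^ (1:ℝ) :=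
            Real.rpow_le_rpow_of_exponent_le hj (by linarith)
        _ ≤ 2 := by simpa using h1
    nlinarith
  rcases le_total (jx ζ ^ al σ) (jv ζ) with h' | h'
  · have : rr σ ζ ≤ lam σ ζ := by
      unfold rr lam
      rw [mul_comm, Real.rpow_mul hj0.le]
      exact Real.rpow_le_rpow hb h' hσ.le
    nlinarith
  · have hT : TT σ ζ ≤ 2 * jx ζ ^ al σ := by unfold TT; linarith
    have hT2 : (2 * jx ζ ^ al σ) ^ (-3/2:ℝ) ≤ TT σ ζ ^ (-3/2:ℝ) :=
      Real.rpow_le_rpow_of_nonpos hT0 hT (by norm_num)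
    rw [Real.mul_rpow (by norm_num) hb, ← Real.rpow_mul hj0.le] at hT2
    have h4 : (1/4:ℝ) ≤ 2 ^ (-3/2:ℝ) := by
      calc (1/4:ℝ) = 2 ^ (-2:ℝ) := by rw [Real.rpow_neg (by norm_num)]; norm_num
        _ ≤ _ := Real.rpow_le_rpow_of_exponent_le (by norm_num) (by norm_num)
    have h5 : jx ζ / 2 ≤ ‖xC ζ‖ ^ 2 := by unfold jx; nlinarith
    have h6 : rr σ ζ ^ 2 = jx ζ ^ (al σ / 2) * jx ζ ^ (al σ * (-3/2:ℝ)) * jx ζ := by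
      unfold rr
      rw [← Real.rpow_natCast, ← Real.rpow_mul hj0.le]
      nth_rewrite 4 [← Real.rpow_one (jx ζ)]
      rw [← Real.rpow_add hj0, ← Real.rpow_add hj0]
      congr 1
      push_cast
      linarith [al_eq hσ]
    have h7 : 1/8 * rr σ ζ ^ 2 ≤ XX (psi σ) ζ := by
      refine le_trans ?_ hlow
      rw [h6]
      calc _ = jx ζ ^ (al σ / 2) * (1/4 * jx ζ ^ (al σ * (-3/2:ℝ))) * (jx ζ / 2) := by ring
        _ ≤ jx ζ ^ (al σ / 2) * (2 ^ (-3/2:ℝ) * jx ζ ^ (al σ * (-3/2:ℝ))) * (jx ζ / 2) := by gcongr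
        _ ≤ _ := by gcongr
    nlinarith

end
end Hypo

namespace Hypo

open Function

/-- weighted `L²` integrals -/
def wI (m : Z n → ℝ) (W : 𝓢(Z n, ℂ)) : ℝ := ∫ ζ, m ζ * ‖W ζ‖ ^ 2

lemma wI_mono {m m' : Z n → ℝ} (hm : m.HasTemperateGrowth) (hm' : m'.HasTemperateGrowth)
    (h : ∀ ζ, m ζ ≤ m' ζ) (W : 𝓢(Z n, ℂ)) : wI m W ≤ wI m' W :=
  integral_mono (integrable_w hm W) (integrable_w hm' W)
    fun ζ => mul_le_mul_of_nonneg_right (h ζ) (sq_nonneg _)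

lemma wI_nonneg {m : Z n → ℝ} (h : ∀ ζ, 0 ≤ m ζ) (W : 𝓢(Z n, ℂ)) : 0 ≤ wI m W :=
  integral_nonneg fun ζ => mul_nonneg (h ζ) (sq_nonneg _)

lemma wI_add {m m' : Z n → ℝ} (hm : m.HasTemperateGrowth) (hm' : m'.HasTemperateGrowth)
    (W : 𝓢(Z n, ℂ)) : wI (fun ζ => m ζ + m' ζ) W = wI m W + wI m' W := by
  unfold wI
  rw [← integral_add (integrable_w hm W) (integrable_w hm' W)]
  congr 1; ext ζ; ring

lemma wI_const_mul (c : ℝ) (m : Z n → ℝ) (W : 𝓢(Z n, ℂ)) :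
    wI (fun ζ => c * m ζ) W = c * wI m W := by
  unfold wI
  rw [← integral_const_mul]
  congr 1; ext ζ; ring

lemma sq_tg {m : Z n → ℝ} (hm : m.HasTemperateGrowth) : (fun ζ => m ζ ^ 2).HasTemperateGrowth := by
  simp_rw [pow_two]; exact hm.mul hm

lemma bil (β W : 𝓢(Z n, ℂ)) {m m' p p' A B : Z n → ℝ} (hm : m.HasTemperateGrowth)
    (hm' : m'.HasTemperateGrowth) (hp : p.HasTemperateGrowth) (hp' : p'.HasTemperateGrowth)
    (hA : A.HasTemperateGrowth) (hB : B.HasTemperateGrowth) (N : ℕ)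
    (hker : ∀ ζ t, |m ζ * m' (ζ - t) - p ζ * p' (ζ - t)| ≤ (1 + ‖t‖) ^ N * (A (ζ - t) * B ζ))
    {ε : ℝ} (hε : 0 < ε) :
    |(∫ ζ, inner ℝ (mu m W ζ) (conv β (mu m' W) ζ)) - ∫ ζ, inner ℝ (mu p W ζ) (conv β (mu p' W) ζ)|
      ≤ (∫ t, (1 + ‖t‖) ^ N * ‖β t‖) / 2 *
        (ε * wI (fun ζ => A ζ ^ 2) W + ε⁻¹ * wI (fun ζ => B ζ ^ 2) W) := by
  set Kern : Z n → Z n → ℂ := fun ζ t => starRingEnd ℂ (W ζ) *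
    (β t * ((m ζ * m' (ζ - t) - p ζ * p' (ζ - t) : ℝ) * W (ζ - t))) with hK
  have hcW := W.continuous
  have hcβ := β.continuous
  have e1 : ∀ ζ, ∫ t, Kern ζ t = conv β (mu m' W) ζ * starRingEnd ℂ (mu m W ζ)
      - conv β (mu p' W) ζ * starRingEnd ℂ (mu p W ζ) := by
    intro ζ
    have i1 := (conv_integrable β (mu m' W) ζ).mul_const (starRingEnd ℂ (mu m W ζ))
    have i2 := (conv_integrable β (mu p' W) ζ).mul_const (starRingEnd ℂ (mu p W ζ))
    rw [conv_apply, conv_apply, ← integral_mul_const, ← integral_mul_const, ← integral_sub i1 i2]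
    refine integral_congr_ae (Filter.Eventually.of_forall fun t => ?_)
    simp only [hK, mu_apply hm, mu_apply hm', mu_apply hp, mu_apply hp', map_mul, Complex.conj_ofReal]
    push_cast
    ring
  have i1 := integrable_mul_norm (conv β (mu m' W)) (mu m W)
  have i2 := integrable_mul_norm (conv β (mu p' W)) (mu p W)
  have e2 : (∫ ζ, inner ℝ (mu m W ζ) (conv β (mu m' W) ζ))
      - ∫ ζ, inner ℝ (mu p W ζ) (conv β (mu p' W) ζ) = (∫ ζ, ∫ t, Kern ζ t).re := by
    rw [← integral_sub (integrable_inner _ _) (integrable_inner _ _)]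
    have : (∫ ζ, ∫ t, Kern ζ t).re = ∫ ζ, (∫ t, Kern ζ t).re := by
      refine (integral_re (𝕜 := ℂ) (f := fun ζ => ∫ t, Kern ζ t) ?_).symm
      exact (i1.sub i2).congr (Filter.Eventually.of_forall fun ζ => (e1 ζ).symm)
    rw [this]
    refine integral_congr_ae (Filter.Eventually.of_forall fun ζ => ?_)
    show inner ℝ _ _ - inner ℝ _ _ = (∫ t, Kern ζ t).re
    rw [e1, Complex.sub_re, Complex.inner, Complex.inner]
  rw [e2]
  refine (Complex.abs_re_le_norm _).trans ?_
  have hAc := hA.1.continuous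
  have hBc := hB.1.continuous
  have key := young (k := fun t => (1 + ‖t‖) ^ N * ‖β t‖) (A := fun ζ => A ζ * ‖W ζ‖)
    (B := fun ζ => B ζ * ‖W ζ‖) (ker_integrable β N) (fun t => by positivity) (by fun_prop)
    (by fun_prop) (by fun_prop)
    ((integrable_w (sq_tg hA) W).congr (Filter.Eventually.of_forall fun ζ => (mul_pow _ _ _).symm))
    ((integrable_w (sq_tg hB) W).congr (Filter.Eventually.of_forall fun ζ => (mul_pow _ _ _).symm))
    Kern (fun ζ t => by
      simp only [hK, norm_mul, RCLike.norm_conj, Complex.norm_real, Real.norm_eq_abs]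
      calc _ = |m ζ * m' (ζ - t) - p ζ * p' (ζ - t)| * (‖W ζ‖ * ‖β t‖ * ‖W (ζ - t)‖) := by ring
        _ ≤ (1 + ‖t‖) ^ N * (A (ζ - t) * B ζ) * (‖W ζ‖ * ‖β t‖ * ‖W (ζ - t)‖) := by
            gcongr; exact hker ζ t
        _ = _ := by ring) hε
  simp only [mul_pow] at key
  exact key

lemma bil0 (β W : 𝓢(Z n, ℂ)) {m m' A B : Z n → ℝ} (hm : m.HasTemperateGrowth)
    (hm' : m'.HasTemperateGrowth)
    (hA : A.HasTemperateGrowth) (hB : B.HasTemperateGrowth) (N : ℕ)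
    (hker : ∀ ζ t, |m ζ * m' (ζ - t)| ≤ (1 + ‖t‖) ^ N * (A (ζ - t) * B ζ))
    {ε : ℝ} (hε : 0 < ε) :
    |∫ ζ, inner ℝ (mu m W ζ) (conv β (mu m' W) ζ)|
      ≤ (∫ t, (1 + ‖t‖) ^ N * ‖β t‖) / 2 *
        (ε * wI (fun ζ => A ζ ^ 2) W + ε⁻¹ * wI (fun ζ => B ζ ^ 2) W) := by
  have h0 : (fun _ : Z n => (0:ℝ)).HasTemperateGrowth := HasTemperateGrowth.const 0
  have := bil β W hm hm' h0 h0 hA hB N (by simpa using hker) hε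
  simpa [mu_apply h0] using this

lemma conv_nonneg' {b : 𝓢(Z n, ℂ)} {b' : Z n → ℝ} (hb : ∀ x, b x = b' x) (hb0 : ∀ x, 0 ≤ b' x)
    (V : 𝓢(Z n, ℂ)) : 0 ≤ ∫ ζ, inner ℝ (V ζ) (conv (𝓕 b) V ζ) := by
  refine (conv_nonneg hb hb0 V).trans (le_of_eq ?_)
  have h : Integrable fun ζ => starRingEnd ℂ (V ζ) * conv (𝓕 b) V ζ :=
    (integrable_mul_norm (conv (𝓕 b) V) V).congr (Filter.Eventually.of_forall fun ζ => mul_comm _ _)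
  refine (integral_re (𝕜 := ℂ) h).symm.trans ?_
  refine integral_congr_ae (Filter.Eventually.of_forall fun ζ => ?_)
  simp [Complex.inner, mul_comm]

lemma test_eq {m : Z n → ℝ} (hm : m.HasTemperateGrowth) (σ a0 : ℝ) (β W Φ : 𝓢(Z n, ℂ))
    (hΦ : ∀ ζ, Φ ζ = Dop W ζ + (a0 : ℂ) * mu (lam σ) W ζ + conv β (mu (lam σ) W) ζ) :
    ∫ ζ, inner ℝ (mu m W ζ) (Φ ζ) = (1 / 2) * (∫ ζ, XX m ζ * ‖W ζ‖ ^ 2)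
      + a0 * wI (fun ζ => m ζ * lam σ ζ) W
      + ∫ ζ, inner ℝ (mu m W ζ) (conv β (mu (lam σ) W) ζ) := by
  have i3 : Integrable fun ζ => a0 * (m ζ * lam σ ζ * ‖W ζ‖ ^ 2) :=
    (integrable_w (hm.mul (lam_tg σ)) W).const_mul a0
  have hpt : ∀ ζ, inner ℝ (mu m W ζ) (Φ ζ) = inner ℝ (mu m W ζ) (Dop W ζ)
      + a0 * (m ζ * lam σ ζ * ‖W ζ‖ ^ 2) + inner ℝ (mu m W ζ) (conv β (mu (lam σ) W) ζ) := by
    intro ζ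
    rw [hΦ, inner_add_right, inner_add_right, inner_ofReal_mul_right]
    congr 2
    rw [mu_apply hm, mu_apply (lam_tg σ), inner_ofReal_mul_left, inner_ofReal_mul_right,
      real_inner_self_eq_norm_sq]
    ring
  have i1 := integrable_inner (mu m W) (Dop W)
  have i13 : Integrable fun ζ => inner ℝ (mu m W ζ) (Dop W ζ) + a0 * (m ζ * lam σ ζ * ‖W ζ‖ ^ 2) :=
    i1.add i3
  rw [integral_congr_ae (Filter.Eventually.of_forall hpt),
    integral_add i13 (integrable_inner _ _), integral_add i1 i3, (ibp hm W).2,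
    integral_const_mul]
  rfl

lemma test_cs {m : Z n → ℝ} (hm : m.HasTemperateGrowth) (W Φ : 𝓢(Z n, ℂ)) {ε : ℝ} (hε : 0 < ε) :
    |∫ ζ, inner ℝ (mu m W ζ) (Φ ζ)| ≤ 1 / 2 * (ε * wI (fun ζ => m ζ ^ 2) W + ε⁻¹ * ∫ ζ, ‖Φ ζ‖ ^ 2) := by
  have i1 : Integrable fun ζ => ε * (m ζ ^ 2 * ‖W ζ‖ ^ 2) := (integrable_w (sq_tg hm) W).const_mul ε
  have i2 : Integrable fun ζ => ε⁻¹ * ‖Φ ζ‖ ^ 2 := (integrable_sq Φ).const_mul _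
  have e : 1 / 2 * (ε * wI (fun ζ => m ζ ^ 2) W + ε⁻¹ * ∫ ζ, ‖Φ ζ‖ ^ 2)
      = ∫ ζ, 1 / 2 * (ε * (m ζ ^ 2 * ‖W ζ‖ ^ 2) + ε⁻¹ * ‖Φ ζ‖ ^ 2) := by
    rw [integral_const_mul, integral_add i1 i2, integral_const_mul, integral_const_mul]; rfl
  rw [e, ← Real.norm_eq_abs]
  refine norm_integral_le_of_norm_le ((i1.add i2).const_mul _) (Filter.Eventually.of_forall fun ζ => ?_)
  refine (norm_inner_le_norm _ _).trans ?_
  rw [norm_mu hm, ← sq_abs (m ζ)]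
  have h1 : 0 ≤ ε⁻¹ / 2 * (ε * (|m ζ| * ‖W ζ‖) - ‖Φ ζ‖) ^ 2 := by positivity
  have h2 : ε⁻¹ * ε = 1 := inv_mul_cancel₀ hε.ne'
  calc _ ≤ |m ζ| * ‖W ζ‖ * ‖Φ ζ‖ + ε⁻¹ / 2 * (ε * (|m ζ| * ‖W ζ‖) - ‖Φ ζ‖) ^ 2 := by linarith
    _ = (ε⁻¹ * ε) * (ε * (|m ζ| ^ 2 * ‖W ζ‖ ^ 2) / 2) + ε⁻¹ / 2 * ‖Φ ζ‖ ^ 2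
        + |m ζ| * ‖W ζ‖ * ‖Φ ζ‖ * (1 - ε⁻¹ * ε) := by ring
    _ = _ := by rw [h2]; ring

/-- the final absorption argument -/
lemma absorb {a0 κ : ℝ} (ha : 0 < a0) (hκ : 0 ≤ κ) : ∃ C : ℝ, 0 < C ∧ ∀ X Y S N L M : ℝ,
    0 ≤ X → 0 ≤ Y → 0 ≤ S → 0 ≤ N → 0 ≤ L → 0 ≤ M → S ≤ (X + Y) / 2 →
    (∀ ε > 0, L ≤ ε * X + ε⁻¹ * N) →
    (∀ ε > 0, a0 * S ≤ 1 / 2 * (ε * Y + ε⁻¹ * M) + κ / 2 * (ε⁻¹ * L + ε * (2 * Y + 2 * S))) →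
    (∀ ε > 0, Y ≤ 16 * (1 / 2 * (ε * Y + ε⁻¹ * M) + a0 * S + κ / 2 * (ε⁻¹ * S + ε * (2 * Y + 8 * S)))
      + S + 4 * N) →
    (∀ ε > 0, a0 * X ≤ 1 / 2 * (ε * (2 * X + 2 * Y) + ε⁻¹ * M) + (S + Y)
      + κ / 2 * (ε * X + ε⁻¹ * Y)) →
    X + Y ≤ C * (M + N) := by
  -- step 2
  obtain ⟨C2, hC2, h2⟩ : ∃ C2 : ℝ, 0 < C2 ∧ ∀ Y S N M : ℝ, 0 ≤ Y → 0 ≤ S → 0 ≤ N → 0 ≤ M →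
    (∀ ε > 0, Y ≤ 16 * (1 / 2 * (ε * Y + ε⁻¹ * M) + a0 * S + κ / 2 * (ε⁻¹ * S + ε * (2 * Y + 8 * S)))
      + S + 4 * N) → Y ≤ C2 * (M + N + S) := by
    set e : ℝ := (16 + 32 * κ)⁻¹ with he
    have he0 : 0 < e := by positivity
    have he1 : e * (16 + 32 * κ) = 1 := inv_mul_cancel₀ (by positivity)
    refine ⟨2 * (8 * e⁻¹ + 16 * a0 + 8 * κ * e⁻¹ + 64 * κ * e + 5), by positivity, ?_⟩
    intro Y S N M hY hS hN hM h
    have h := h e he0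
    have h3 : e * (8 + 16 * κ) * Y = Y / 2 := by
      have : e * (8 + 16 * κ) = 1/2 := by linarith
      rw [this]; ring
    have p1 : 0 ≤ e⁻¹ * N := by positivity
    have p2 : 0 ≤ a0 * N := by positivity
    have p3 : 0 ≤ κ * e⁻¹ * N := by positivity
    have p4 : 0 ≤ κ * e * N := by positivity
    have p5 : 0 ≤ a0 * M := by positivity
    have p6 : 0 ≤ κ * e⁻¹ * M := by positivity
    have p7 : 0 ≤ κ * e * M := by positivity
    have p8 : 0 ≤ e⁻¹ * S := by positivity
    nlinarith
  obtain ⟨C3, hC3, h3⟩ : ∃ C3 : ℝ, 0 < C3 ∧ ∀ X Y S M : ℝ, 0 ≤ X → 0 ≤ Y → 0 ≤ S → 0 ≤ M →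
    (∀ ε > 0, a0 * X ≤ 1 / 2 * (ε * (2 * X + 2 * Y) + ε⁻¹ * M) + (S + Y)
      + κ / 2 * (ε * X + ε⁻¹ * Y)) → X ≤ C3 * (M + S + Y) := by
    set e : ℝ := a0 * (2 + κ)⁻¹ with he
    have he0 : 0 < e := by positivity
    have he1 : e * (1 + κ / 2) = a0 / 2 := by rw [he]; field_simp
    refine ⟨2 * a0⁻¹ * (e⁻¹ + e + 1 + κ * e⁻¹), by positivity, ?_⟩
    intro X Y S M hX hY hS hM h
    have h := h e he0
    have h3 : e * (1 + κ / 2) * X = a0 / 2 * X := by rw [he1]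
    have p1 : 0 ≤ e⁻¹ * S := by positivity
    have p2 : 0 ≤ e * S := by positivity
    have p3 : 0 ≤ κ * e⁻¹ * S := by positivity
    have p4 : 0 ≤ e⁻¹ * Y := by positivity
    have p5 : 0 ≤ κ * e⁻¹ * Y := by positivity
    have p6 : 0 ≤ e⁻¹ * M := by positivity
    have p7 : 0 ≤ e * M := by positivity
    have p8 : 0 ≤ κ * e⁻¹ * M := by positivity
    have h4 : a0 / 2 * X ≤ (e⁻¹ + e + 1 + κ * e⁻¹) * (M + S + Y) := by nlinarith
    calc X = 2 * a0⁻¹ * (a0 / 2 * X) := by field_simp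
      _ ≤ 2 * a0⁻¹ * ((e⁻¹ + e + 1 + κ * e⁻¹) * (M + S + Y)) := by gcongr
      _ = _ := by ring
  -- combine
  set C4 := C3 + C3 * C2 + C2 with hC4
  have hC40 : 0 < C4 := by positivity
  -- X + Y ≤ C4 (M + N + S)
  set e : ℝ := a0 / (2 * C4 * (1 + 4 * κ)) with he
  have he0 : 0 < e := by positivity
  have he1 : e * (2 * C4 * (1 + 4 * κ)) = a0 := by rw [he]; field_simp
  refine ⟨2 * (C4 + C4 * a0⁻¹ * (e⁻¹ + κ * e⁻¹ * (e ^ 2)⁻¹)), by positivity, ?_⟩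
  intro X Y S N L M hX hY hS hN hL hM hSXY hLX H1 H2 H3
  have k2 := h2 Y S N M hY hS hN hM H2
  have k3 := h3 X Y S M hX hY hS hM H3
  have k4 : X + Y ≤ C4 * (M + N + S) := by
    have : C3 * Y ≤ C3 * (C2 * (M + N + S)) := by gcongr
    nlinarith [mul_nonneg hC3.le hN]
  have k5 := H1 e he0
  have k6 := hLX (e ^ 2) (by positivity)
  have k7 : e⁻¹ * L ≤ e * X + e⁻¹ * (e ^ 2)⁻¹ * N := by
    calc e⁻¹ * L ≤ e⁻¹ * (e ^ 2 * X + (e ^ 2)⁻¹ * N) := by gcongr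
      _ = _ := by field_simp
  have k8 : a0 * S ≤ e * (1 + 4 * κ) / 2 * (X + Y) + (e⁻¹ + κ * e⁻¹ * (e ^ 2)⁻¹) * (M + N) := by
    have q1 : κ / 2 * (e⁻¹ * L + e * (2 * Y + 2 * S)) ≤
      κ / 2 * ((e * X + e⁻¹ * (e ^ 2)⁻¹ * N) + e * (2 * Y + (X + Y))) := by
      gcongr; linarith
    have p1 : 0 ≤ e * X := by positivity
    have p2 : 0 ≤ e⁻¹ * N := by positivity
    have p3 : 0 ≤ κ * e⁻¹ * (e ^ 2)⁻¹ * M := by positivity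
    have p4 : 0 ≤ κ * e⁻¹ * (e ^ 2)⁻¹ * N := by positivity
    have p5 : 0 ≤ κ * e * X := by positivity
    have p6 : 0 ≤ e⁻¹ * M := by positivity
    have p7 : 0 ≤ κ * e * Y := by positivity
    nlinarith
  have k9 : C4 * S ≤ (X + Y) / 2 * (1 / 2) + C4 * a0⁻¹ * (e⁻¹ + κ * e⁻¹ * (e ^ 2)⁻¹) * (M + N) := by
    have e3 : C4 * a0⁻¹ * (e * (1 + 4 * κ) / 2) = 1 / 4 := by rw [he]; field_simp; norm_num
    calc C4 * S = C4 * a0⁻¹ * (a0 * S) := by field_simp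
      _ ≤ C4 * a0⁻¹ * (e * (1 + 4 * κ) / 2 * (X + Y) + (e⁻¹ + κ * e⁻¹ * (e ^ 2)⁻¹) * (M + N)) := by
        gcongr
      _ = C4 * a0⁻¹ * (e * (1 + 4 * κ) / 2) * (X + Y)
          + C4 * a0⁻¹ * (e⁻¹ + κ * e⁻¹ * (e ^ 2)⁻¹) * (M + N) := by ring
      _ = _ := by rw [e3]; ring
  nlinarith

end Hypo

namespace Hypo

open Function

lemma tg_mul {f g : Z n → ℝ} (hf : f.HasTemperateGrowth) (hg : g.HasTemperateGrowth) :
    (fun ζ => f ζ * g ζ).HasTemperateGrowth := hf.mul hg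
lemma tg_add {f g : Z n → ℝ} (hf : f.HasTemperateGrowth) (hg : g.HasTemperateGrowth) :
    (fun ζ => f ζ + g ζ).HasTemperateGrowth := hf.add hg
lemma tg_cmul (c : ℝ) {g : Z n → ℝ} (hg : g.HasTemperateGrowth) :
    (fun ζ => c * g ζ).HasTemperateGrowth := (HasTemperateGrowth.const c).mul hg

lemma wI_le_of {W : 𝓢(Z n, ℂ)} {m p : Z n → ℝ} {c : ℝ} (hm : m.HasTemperateGrowth)
    (hp : p.HasTemperateGrowth) (h : ∀ ζ, m ζ ≤ c * p ζ) : wI m W ≤ c * wI p W := by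
  rw [← wI_const_mul]
  exact wI_mono hm ((HasTemperateGrowth.const c).mul hp) h W

lemma wI_le_of2 {W : 𝓢(Z n, ℂ)} {m p p' : Z n → ℝ} {c c' : ℝ} (hm : m.HasTemperateGrowth)
    (hp : p.HasTemperateGrowth) (hp' : p'.HasTemperateGrowth)
    (h : ∀ ζ, m ζ ≤ c * p ζ + c' * p' ζ) : wI m W ≤ c * wI p W + c' * wI p' W := by
  have h1 := tg_cmul c hp
  have h2 := tg_cmul c' hp'
  rw [← wI_const_mul, ← wI_const_mul, ← wI_add h1 h2]
  exact wI_mono hm (tg_add h1 h2) h W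

/-- the core subelliptic estimate -/
theorem core {σ a0 : ℝ} (hσ : 0 < σ) (hσ1 : σ < 1) (ha : 0 < a0) {b : 𝓢(Z n, ℂ)} {b' : Z n → ℝ}
    (hb : ∀ x, b x = b' x) (hb0 : ∀ x, 0 ≤ b' x) :
    ∃ C : ℝ, 0 < C ∧ ∀ W Φ : 𝓢(Z n, ℂ),
      (∀ ζ, Φ ζ = Dop W ζ + (a0 : ℂ) * mu (lam σ) W ζ + conv (𝓕 b) (mu (lam σ) W) ζ) →
      wI (fun ζ => lam σ ζ ^ 2) W + wI (fun ζ => rr σ ζ ^ 2) W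
        ≤ C * ((∫ ζ, ‖Φ ζ‖ ^ 2) + wI (fun _ => 1) W) := by
  set κ := ∫ t, (1 + ‖t‖) ^ 2 * ‖𝓕 b t‖ with hκ
  have hκ0 : 0 ≤ κ := integral_nonneg fun t => by positivity
  obtain ⟨C, hC, H⟩ := absorb ha hκ0
  refine ⟨C, hC, fun W Φ hΦ => ?_⟩
  have tl := lam_tg (n := n) σ
  have tlh := lh_tg (n := n) σ
  have tr := rr_tg (n := n) σ
  have tq := qq_tg (n := n) σ
  have tG := GG_tg (n := n) σ
  have tp := psi_tg (n := n) σ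
  have t1 : (fun _ : Z n => (1:ℝ)).HasTemperateGrowth := HasTemperateGrowth.const 1
  have l1 := one_le_lam (n := n) hσ
  have r1 := one_le_rr (n := n) hσ
  have q1 : ∀ ζ : Z n, 1 ≤ qq σ ζ := fun ζ => (one_le_lh hσ ζ).trans (lh_le_qq hσ ζ)
  refine H _ _ (wI (fun ζ => lam σ ζ * rr σ ζ) W) _ (wI (lam σ) W) _
    (wI_nonneg (fun ζ => sq_nonneg _) W) (wI_nonneg (fun ζ => sq_nonneg _) W)
    (wI_nonneg (fun ζ => by have := l1 ζ; have := r1 ζ; positivity) W)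
    (wI_nonneg (fun ζ => zero_le_one) W) (wI_nonneg (fun ζ => by have := l1 ζ; positivity) W)
    (integral_nonneg fun ζ => sq_nonneg _) ?_ ?_ ?_ ?_ ?_
  · have := wI_le_of2 (W := W) (c := 1/2) (c' := 1/2) (tg_mul tl tr) (sq_tg tl) (sq_tg tr)
      (fun ζ => by nlinarith [sq_nonneg (lam σ ζ - rr σ ζ)])
    linarith
  · intro ε hε
    refine wI_le_of2 (W := W) tl (sq_tg tl) t1 (fun ζ => ?_)
    have h2 : ε⁻¹ * ε = 1 := inv_mul_cancel₀ hε.ne'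
    have h3 : 0 < ε⁻¹ := by positivity
    have : ε * lam σ ζ ^ 2 + ε⁻¹ * 1 - lam σ ζ = ε⁻¹ * ((ε * lam σ ζ - 1/2) ^ 2 + 3/4)
      + (ε⁻¹ * ε - 1) * (lam σ ζ * (1 - ε * lam σ ζ)) := by ring
    rw [h2] at this
    have : 0 ≤ ε⁻¹ * ((ε * lam σ ζ - 1/2) ^ 2 + 3/4) := by positivity
    linarith
  · intro ε hε
    have E := test_eq tr σ a0 (𝓕 b) W Φ hΦ
    have Cs := (abs_le.1 (test_cs tr W Φ hε)).2
    have P := conv_nonneg' hb hb0 (mu (qq σ) W)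
    have B := (abs_le.1 (bil (𝓕 b) W tr tl tq tq tlh (tg_add tr tq) 2 (ker_r hσ hσ1)
      (ε := ε⁻¹) (by positivity))).1
    rw [inv_inv] at B
    have e0 : ∫ ζ, XX (rr σ) ζ * ‖W ζ‖ ^ 2 = 0 := by simp [XX_rr]
    have e1 : wI (fun ζ => rr σ ζ * lam σ ζ) W = wI (fun ζ => lam σ ζ * rr σ ζ) W := by
      congr 1; ext ζ; ring
    have e2 : wI (fun ζ => lh σ ζ ^ 2) W = wI (lam σ) W := by
      congr 1; ext ζ; exact lh_sq σ ζ
    have e3 : wI (fun ζ => (rr σ ζ + qq σ ζ) ^ 2) W ≤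
        2 * wI (fun ζ => rr σ ζ ^ 2) W + 2 * wI (fun ζ => lam σ ζ * rr σ ζ) W :=
      wI_le_of2 (sq_tg (tg_add tr tq)) (sq_tg tr) (tg_mul tl tr) (fun ζ => by
        rw [← qq_sq]
        nlinarith [sq_nonneg (rr σ ζ - qq σ ζ)])
    rw [e0, e1] at E
    rw [e2] at B
    have B2 : κ / 2 * (ε⁻¹ * wI (lam σ) W + ε * wI (fun ζ => (rr σ ζ + qq σ ζ) ^ 2) W) ≤
      κ / 2 * (ε⁻¹ * wI (lam σ) W + ε * (2 * wI (fun ζ => rr σ ζ ^ 2) W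
        + 2 * wI (fun ζ => lam σ ζ * rr σ ζ) W)) := by gcongr
    linarith
  · intro ε hε
    have E := test_eq tp σ a0 (𝓕 b) W Φ hΦ
    have Cs := (abs_le.1 (test_cs tp W Φ hε)).2
    have B := (abs_le.1 (bil0 (𝓕 b) W tp tl tq (tg_add tr (tg_cmul 2 tq)) 2
      (fun ζ t => by
        rw [abs_mul, abs_of_nonneg (by linarith [l1 (ζ - t)] : 0 ≤ lam σ (ζ - t))]
        refine (mul_le_mul_of_nonneg_right (psi_le hσ ζ) (by linarith [l1 (ζ - t)])).trans ?_
        exact ker_psi hσ hσ1 ζ t)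
      (ε := ε⁻¹) (by positivity))).1
    rw [inv_inv] at B
    have e2 : wI (fun ζ => qq σ ζ ^ 2) W = wI (fun ζ => lam σ ζ * rr σ ζ) W := by
      congr 1; ext ζ; exact qq_sq σ ζ
    have e3 : wI (fun ζ => (rr σ ζ + 2 * qq σ ζ) ^ 2) W ≤
        2 * wI (fun ζ => rr σ ζ ^ 2) W + 8 * wI (fun ζ => lam σ ζ * rr σ ζ) W :=
      wI_le_of2 (sq_tg (tg_add tr (tg_cmul 2 tq))) (sq_tg tr) (tg_mul tl tr)
        (fun ζ => by
          rw [← qq_sq]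
          nlinarith [sq_nonneg (rr σ ζ - 2 * qq σ ζ)])
    have e4 : wI (fun ζ => psi σ ζ ^ 2) W ≤ wI (fun ζ => rr σ ζ ^ 2) W :=
      wI_mono (sq_tg tp) (sq_tg tr) (fun ζ => by
        rw [← sq_abs]; have := psi_le hσ ζ; gcongr) W
    have e5 : (-1) * wI (fun ζ => lam σ ζ * rr σ ζ) W ≤ wI (fun ζ => psi σ ζ * lam σ ζ) W := by
      rw [← wI_const_mul]
      refine wI_mono (tg_cmul (-1) (tg_mul tl tr)) (tg_mul tp tl) (fun ζ => ?_) W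
      have h1 := (abs_le.1 (psi_le hσ ζ)).1
      have h2 := l1 ζ
      nlinarith
    have e6 : wI (fun ζ => rr σ ζ ^ 2) W ≤ 8 * (∫ ζ, XX (psi σ) ζ * ‖W ζ‖ ^ 2)
        + wI (fun ζ => lam σ ζ * rr σ ζ) W + 4 * wI (fun _ => 1) W := by
      have i1 := ((ibp tp W).1).const_mul 8
      have i2 := integrable_w (tg_mul tl tr) W
      have i3 := (integrable_w t1 W).const_mul 4
      have i12 : Integrable fun ζ => 8 * (XX (psi σ) ζ * ‖W ζ‖ ^ 2)
        + (lam σ ζ * rr σ ζ) * ‖W ζ‖ ^ 2 := i1.add i2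
      unfold wI
      rw [← integral_const_mul, ← integral_const_mul, ← integral_add i1 i2,
        ← integral_add i12 i3]
      refine integral_mono (integrable_w (sq_tg tr) W) (i12.add i3) fun ζ => ?_
      have := mul_le_mul_of_nonneg_right (XX_psi_ge hσ ζ) (sq_nonneg ‖W ζ‖)
      simp only [Pi.add_apply]
      nlinarith
    rw [e2] at B
    have B2 : κ / 2 * (ε⁻¹ * wI (fun ζ => lam σ ζ * rr σ ζ) W + ε * wI (fun ζ => (rr σ ζ + 2 * qq σ ζ) ^ 2) W) ≤
      κ / 2 * (ε⁻¹ * wI (fun ζ => lam σ ζ * rr σ ζ) W + ε * (2 * wI (fun ζ => rr σ ζ ^ 2) W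
        + 8 * wI (fun ζ => lam σ ζ * rr σ ζ) W)) := by gcongr
    have B3 := mul_le_mul_of_nonneg_left e4 hε.le
    have B4 := mul_le_mul_of_nonneg_left e5 ha.le
    linarith
  · intro ε hε
    have E := test_eq tG σ a0 (𝓕 b) W Φ hΦ
    have Cs := (abs_le.1 (test_cs tG W Φ hε)).2
    have P := conv_nonneg' hb hb0 (mu (lam σ) W)
    have B := (abs_le.1 (bil (𝓕 b) W tG tl tl tl tl tr 2 (fun ζ t => by
        have h1 := lam_le_GG hσ ζ
        have h2 := GG_le hσ hσ1 ζ
        have h3 := l1 (ζ - t)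
        have h4 : (1:ℝ) ≤ (1 + ‖t‖) ^ 2 := one_le_pow₀ (by linarith [norm_nonneg t])
        have h5 := r1 ζ
        rw [← sub_mul, abs_of_nonneg (mul_nonneg (by linarith) (by linarith))]
        calc _ ≤ rr σ ζ * lam σ (ζ - t) := by gcongr; linarith
          _ = 1 * (lam σ (ζ - t) * rr σ ζ) := by ring
          _ ≤ _ := by gcongr) hε)).1
    have e4 : wI (fun ζ => GG σ ζ ^ 2) W ≤
        2 * wI (fun ζ => lam σ ζ ^ 2) W + 2 * wI (fun ζ => rr σ ζ ^ 2) W :=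
      wI_le_of2 (sq_tg tG) (sq_tg tl) (sq_tg tr) (fun ζ => by
        have h1 := lam_le_GG hσ ζ
        have h2 := GG_le hσ hσ1 ζ
        have h3 := l1 ζ
        have h0G : 0 ≤ GG σ ζ := by linarith
        have : GG σ ζ ^ 2 ≤ (lam σ ζ + rr σ ζ) ^ 2 := by gcongr
        nlinarith [sq_nonneg (lam σ ζ - rr σ ζ)])
    have e5 : wI (fun ζ => lam σ ζ ^ 2) W ≤ wI (fun ζ => GG σ ζ * lam σ ζ) W :=
      wI_mono (sq_tg tl) (tg_mul tG tl) (fun ζ => by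
        have h1 := lam_le_GG hσ ζ
        have h3 := l1 ζ
        nlinarith) W
    have e6 : (-2) * (wI (fun ζ => lam σ ζ * rr σ ζ) W + wI (fun ζ => rr σ ζ ^ 2) W)
        ≤ ∫ ζ, XX (GG σ) ζ * ‖W ζ‖ ^ 2 := by
      rw [← wI_add (tg_mul tl tr) (sq_tg tr), ← wI_const_mul]
      refine integral_mono (integrable_w (tg_cmul (-2)
        (tg_add (tg_mul tl tr) (sq_tg tr))) W) (ibp tG W).1 fun ζ => ?_
      have := (abs_le.1 (XX_GG hσ hσ1 ζ)).1
      refine mul_le_mul_of_nonneg_right ?_ (sq_nonneg _)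
      linarith
    have B3 := mul_le_mul_of_nonneg_left e4 hε.le
    have B4 := mul_le_mul_of_nonneg_left e5 ha.le
    linarith

end Hypo

namespace Hypo

open Function

lemma mu_mu {m m' : Z n → ℝ} (hm : m.HasTemperateGrowth) (hm' : m'.HasTemperateGrowth)
    (V : 𝓢(Z n, ℂ)) : mu m (mu m' V) = mu (fun ζ => m ζ * m' ζ) V := by
  ext ζ
  rw [mu_apply hm, mu_apply hm', mu_apply (tg_mul hm hm')]
  push_cast; ring

lemma mu_one (V : 𝓢(Z n, ℂ)) : mu (fun _ => (1:ℝ)) V = V := by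
  ext ζ
  rw [mu_apply (HasTemperateGrowth.const (1:ℝ))]; simp

lemma mu_zero (V : 𝓢(Z n, ℂ)) : mu (fun _ => (0:ℝ)) V = 0 := by
  ext ζ
  rw [mu_apply (HasTemperateGrowth.const (0:ℝ))]; simp

lemma wI_mu {m p : Z n → ℝ} (hm : m.HasTemperateGrowth) (V : 𝓢(Z n, ℂ)) :
    wI p (mu m V) = wI (fun ζ => p ζ * m ζ ^ 2) V := by
  unfold wI
  congr 1; ext ζ
  rw [norm_mu hm, mul_pow, sq_abs]; ring

/-- weighted bound for commutator-like operators -/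
lemma comm_bound (κ : 𝓢(Z n, ℂ)) (N : ℕ) {c : ℝ} (hc : 0 ≤ c) :
    ∃ C : ℝ, 0 < C ∧ ∀ (V : 𝓢(Z n, ℂ)) (m1 m2 m3 m4 p : Z n → ℝ),
      m1.HasTemperateGrowth → m2.HasTemperateGrowth → m3.HasTemperateGrowth →
      m4.HasTemperateGrowth → p.HasTemperateGrowth →
      (∀ ζ t, |m1 ζ * m2 (ζ - t) - m3 ζ * m4 (ζ - t)| ≤ c * (1 + ‖t‖) ^ N * p (ζ - t)) →
      ∫ ζ, ‖mu m1 (conv κ (mu m2 V)) ζ - mu m3 (conv κ (mu m4 V)) ζ‖ ^ 2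
        ≤ C * wI (fun ζ => p ζ ^ 2) V := by
  have hI := ker_integrable κ N
  have hI0 : 0 ≤ ∫ t, (1 + ‖t‖) ^ N * ‖κ t‖ := integral_nonneg fun t => by positivity
  refine ⟨((∫ t, c * ((1 + ‖t‖) ^ N * ‖κ t‖)) + 1) ^ 2, ?_, ?_⟩
  · have : 0 ≤ ∫ t, c * ((1 + ‖t‖) ^ N * ‖κ t‖) := integral_nonneg fun t => by positivity
    positivity
  intro V m1 m2 m3 m4 p h1 h2 h3 h4 hp h
  have hκc := κ.continuous
  have hVc := V.continuous
  have hpc : Continuous p := hp.1.continuous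
  have key := young2 (k := fun t => c * ((1 + ‖t‖) ^ N * ‖κ t‖)) (A := fun ζ => p ζ * ‖V ζ‖)
    (hI.const_mul c) (fun t => by positivity) (by fun_prop) (by fun_prop)
    (by
      refine (integrable_w (sq_tg hp) V).congr (Filter.Eventually.of_forall fun ζ => ?_)
      simp only [mul_pow])
    (f := (mu m1 (conv κ (mu m2 V)) - mu m3 (conv κ (mu m4 V)) : 𝓢(Z n, ℂ)))
    (SchwartzMap.continuous _) (integrable_sq _)
    (fun ζ t => κ t * (((m1 ζ * m2 (ζ - t) - m3 ζ * m4 (ζ - t) : ℝ) : ℂ) * V (ζ - t)))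
    (by
      intro ζ
      rw [sub_apply, mu_apply h1, mu_apply h3, conv_apply, conv_apply,
        ← integral_const_mul, ← integral_const_mul, ← integral_sub]
      · congr 1; ext t
        rw [mu_apply h2, mu_apply h4]; push_cast; ring
      · exact (conv_integrable κ _ ζ).const_mul _
      · exact (conv_integrable κ _ ζ).const_mul _)
    (by
      intro ζ t
      rw [norm_mul, norm_mul, Complex.norm_real, Real.norm_eq_abs]
      calc _ ≤ ‖κ t‖ * (c * (1 + ‖t‖) ^ N * p (ζ - t) * ‖V (ζ - t)‖) := by
            gcongr; exact h ζ t
        _ = _ := by ring)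
  simp only [sub_apply] at key
  refine key.trans (le_of_eq ?_)
  unfold wI
  congr 1
  congr 1; ext ζ; ring

lemma conv_bound (κ : 𝓢(Z n, ℂ)) (N : ℕ) {c : ℝ} (hc : 0 ≤ c) :
    ∃ C : ℝ, 0 < C ∧ ∀ (V : 𝓢(Z n, ℂ)) (m1 m2 p : Z n → ℝ),
      m1.HasTemperateGrowth → m2.HasTemperateGrowth → p.HasTemperateGrowth →
      (∀ ζ t, |m1 ζ * m2 (ζ - t)| ≤ c * (1 + ‖t‖) ^ N * p (ζ - t)) →
      ∫ ζ, ‖mu m1 (conv κ (mu m2 V)) ζ‖ ^ 2 ≤ C * wI (fun ζ => p ζ ^ 2) V := by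
  obtain ⟨C, hC, H⟩ := comm_bound κ N hc
  refine ⟨C, hC, fun V m1 m2 p h1 h2 hp h => ?_⟩
  have := H V m1 m2 (fun _ => 0) (fun _ => 0) p h1 h2 (HasTemperateGrowth.const (0:ℝ))
    (HasTemperateGrowth.const (0:ℝ)) hp (by simpa using h)
  simpa [mu_zero] using this

/-! ### Peetre-type bounds with natural exponents -/

/-- `⟨ζ⟩^s` -/
def JJ (s : ℝ) (ζ : Z n) : ℝ := jz ζ ^ (s / 2)

lemma JJ_tg (s : ℝ) : (JJ s : Z n → ℝ).HasTemperateGrowth := tg_rpow jz_tg one_le_jz _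
lemma JJ_pos (s : ℝ) (ζ : Z n) : 0 < JJ s ζ := Real.rpow_pos_of_pos (jz_pos ζ) _

lemma pow_ceil {d : ℝ} (hd : 0 ≤ d) {e : ℝ} {N : ℕ} (h : e ≤ N) : (1 + d) ^ e ≤ (1 + d) ^ N := by
  rw [← Real.rpow_natCast]
  exact Real.rpow_le_rpow_of_exponent_le (by linarith) h

lemma JJ_peetre (s : ℝ) : ∃ N : ℕ, ∀ ζ t : Z n, JJ s ζ ≤ (1 + ‖t‖) ^ N * JJ s (ζ - t) := by
  obtain ⟨N, hN⟩ := exists_nat_ge |s|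
  refine ⟨N, fun ζ t => ?_⟩
  have := peetre_real (one_le_half (one_le_jz ζ)) (one_le_half (one_le_jz (ζ - t)))
    (jz_half_diff ζ t) s
  rw [half_rpow (one_le_jz _), half_rpow (one_le_jz _)] at this
  refine this.trans ?_
  have h2 := JJ_pos s (ζ - t)
  have := pow_ceil (norm_nonneg t) hN
  unfold JJ at *
  gcongr

lemma rr_peetre {σ : ℝ} : ∃ N : ℕ, ∀ ζ t : Z n, rr σ ζ ≤ (1 + ‖t‖) ^ N * rr σ (ζ - t) := by
  obtain ⟨N, hN⟩ := exists_nat_ge |2 * (σ * al σ)|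
  refine ⟨N, fun ζ t => ?_⟩
  have := peetre_real (one_le_half (one_le_jx ζ)) (one_le_half (one_le_jx (ζ - t)))
    (jx_half_diff ζ t) (2 * (σ * al σ))
  rw [half_rpow (one_le_jx _), half_rpow (one_le_jx _), mul_div_cancel_left₀ _ (by norm_num)] at this
  refine this.trans ?_
  have h2 : 0 < jx (ζ - t) ^ (σ * al σ) := Real.rpow_pos_of_pos (jx_pos _) _
  have := pow_ceil (norm_nonneg t) hN
  unfold rr
  gcongr

lemma JJ_diff (s : ℝ) : ∃ N : ℕ, ∀ ζ t : Z n,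
    |JJ s ζ - JJ s (ζ - t)| ≤ |s| * (1 + ‖t‖) ^ N * (JJ s (ζ - t) * jv (ζ - t) ^ (-1/2:ℝ)) := by
  obtain ⟨N, hN⟩ := exists_nat_ge (|s - 1| + 1)
  refine ⟨N, fun ζ t => ?_⟩
  have := diff_rpow_real (one_le_half (one_le_jz ζ)) (one_le_half (one_le_jz (ζ - t)))
    (jz_half_diff ζ t) s
  rw [half_rpow (one_le_jz _), half_rpow (one_le_jz _), half_rpow (one_le_jz _)] at this
  refine this.trans ?_
  have h1 := pow_ceil (norm_nonneg t) hN
  have h3 : jz (ζ - t) ^ ((s - 1) / 2) ≤ JJ s (ζ - t) * jv (ζ - t) ^ (-1/2:ℝ) := by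
    have : (s - 1) / 2 = s / 2 + (-1/2) := by ring
    rw [this, Real.rpow_add (jz_pos _)]
    have := JJ_pos s (ζ - t)
    have h4 : jz (ζ - t) ^ (-1/2:ℝ) ≤ jv (ζ - t) ^ (-1/2:ℝ) :=
      Real.rpow_le_rpow_of_nonpos (jv_pos _) (jv_le_jz _) (by norm_num)
    unfold JJ at *
    gcongr
  have h5 : 0 ≤ jz (ζ - t) ^ ((s - 1) / 2) := (Real.rpow_pos_of_pos (jz_pos _) _).le
  gcongr

lemma lam_diff {σ : ℝ} (hσ : 0 < σ) : ∃ N : ℕ, ∀ ζ t : Z n,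
    |lam σ ζ - lam σ (ζ - t)| ≤ (2 * σ) * (1 + ‖t‖) ^ N * jv (ζ - t) ^ (σ - 1/2) := by
  obtain ⟨N, hN⟩ := exists_nat_ge (|2 * σ - 1| + 1)
  refine ⟨N, fun ζ t => ?_⟩
  have := diff_rpow_real (one_le_half (one_le_jv ζ)) (one_le_half (one_le_jv (ζ - t)))
    (jv_half_diff ζ t) (2 * σ)
  rw [half_rpow (one_le_jv _), half_rpow (one_le_jv _), half_rpow (one_le_jv _),
    mul_div_cancel_left₀ _ (by norm_num), show |2 * σ| = 2 * σ from abs_of_pos (by positivity),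
    show (2 * σ - 1) / 2 = σ - 1/2 by ring] at this
  refine this.trans ?_
  have h1 := pow_ceil (norm_nonneg t) hN
  have h5 : 0 ≤ jv (ζ - t) ^ (σ - 1/2) := (Real.rpow_pos_of_pos (jv_pos _) _).le
  gcongr

/-- error weight -/
def er (σ : ℝ) (ζ : Z n) : ℝ := 1 + jv ζ ^ (σ - 1/2)
lemma er_tg (σ : ℝ) : (er σ : Z n → ℝ).HasTemperateGrowth :=
  tg_add (HasTemperateGrowth.const (1:ℝ)) (tg_rpow jv_tg one_le_jv _)

lemma er_sq {σ δ : ℝ} (hσ : 0 < σ) (hδ : 0 < δ) (ζ : Z n) :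
    er σ ζ ^ 2 ≤ (2 * δ) * lam σ ζ ^ 2 + (2 + 2 * (δ⁻¹) ^ (2 * σ)) * 1 := by
  have h1 := one_le_jv ζ
  have h0 := jv_pos ζ
  have e1 : (jv ζ ^ (σ - 1/2)) ^ 2 = lam σ ζ ^ 2 * (jv ζ)⁻¹ := by
    unfold lam
    rw [← Real.rpow_natCast, ← Real.rpow_natCast, ← Real.rpow_mul h0.le, ← Real.rpow_mul h0.le,
      ← Real.rpow_neg_one, ← Real.rpow_add h0]
    congr 1; push_cast; ring
  have e2 : (jv ζ ^ (σ - 1/2)) ^ 2 ≤ δ * lam σ ζ ^ 2 + (δ⁻¹) ^ (2 * σ) := by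
    have hp : 0 ≤ (δ⁻¹) ^ (2 * σ) := by positivity
    rw [e1]
    rcases le_total (δ⁻¹) (jv ζ) with h | h
    · have : (jv ζ)⁻¹ ≤ δ := inv_le_of_inv_le₀ hδ h
      nlinarith [sq_nonneg (lam σ ζ)]
    · have h2 : (jv ζ)⁻¹ ≤ 1 := inv_le_one_of_one_le₀ h1
      have h3 : lam σ ζ ^ 2 ≤ (δ⁻¹) ^ (2 * σ) := by
        unfold lam
        rw [← Real.rpow_natCast, ← Real.rpow_mul h0.le, mul_comm σ]
        exact Real.rpow_le_rpow h0.le h (by positivity)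
      nlinarith [sq_nonneg (lam σ ζ)]
  unfold er
  nlinarith [sq_nonneg (1 - jv ζ ^ (σ - 1/2))]

end Hypo

namespace Hypo

open Function

lemma Dop_mu {c : Z n → ℝ} (hc : c.HasTemperateGrowth) (U : 𝓢(Z n, ℂ)) (ζ : Z n) :
    Dop (mu c U) ζ = (c ζ : ℂ) * Dop U ζ - (XX c ζ : ℂ) * U ζ := by
  have hd : ∀ e, fderiv ℝ (mu c U) ζ e = (c ζ : ℂ) * fderiv ℝ U ζ e + (fderiv ℝ c ζ e : ℂ) * U ζ := by
    intro e
    have h1 : DifferentiableAt ℝ c ζ := (hc.1.differentiable (by simp)) ζ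
    have h2 : DifferentiableAt ℝ (U : Z n → ℂ) ζ := U.differentiableAt
    have h3 : (mu c U : Z n → ℂ) = fun ζ => c ζ • U ζ := by
      funext ζ; rw [mu_apply hc]; simp
    rw [h3, fderiv_fun_smul h1 h2]
    simp
  rw [Dop_apply, Dop_apply, mu_apply hc]
  have hX : XX c ζ = ∑ i, xC ζ i * fderiv ℝ c ζ (eV i) := by
    unfold XX Xi; simp [map_sum]
  rw [hX]
  push_cast
  simp_rw [hd, mul_add, Finset.sum_add_distrib, mul_sub, Finset.mul_sum, Finset.sum_mul]
  have e1 : ∑ i, (xC ζ i : ℂ) * ((c ζ : ℂ) * fderiv ℝ U ζ (eV i)) =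
      ∑ i, (c ζ : ℂ) * ((xC ζ i : ℂ) * fderiv ℝ U ζ (eV i)) :=
    Finset.sum_congr rfl fun i _ => by ring
  have e2 : ∑ i, (xC ζ i : ℂ) * ((fderiv ℝ c ζ (eV i) : ℂ) * U ζ) =
      ∑ i, (xC ζ i : ℂ) * (fderiv ℝ c ζ (eV i) : ℂ) * U ζ :=
    Finset.sum_congr rfl fun i _ => by ring
  rw [e1, e2]; ring

lemma XX_JJ (s : ℝ) (ζ : Z n) : |XX (JJ s) ζ| ≤ |s| * JJ s ζ := by
  have h0 := jz_pos ζ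
  have h := (hasDerivAt_jz ζ).rpow_const (p := s / 2) (Or.inl (by simpa using h0.ne'))
  simp only [zero_smul, add_zero] at h
  rw [hasDerivAt_line (JJ_tg s) h]
  have h1 : |(inner ℝ (vC ζ) (xC ζ) : ℝ)| ≤ jz ζ := by
    have a1 := abs_real_inner_le_norm (vC ζ) (xC ζ)
    have a2 := norm_vC_le ζ
    have a3 := norm_xC_le ζ
    unfold jz
    nlinarith [norm_nonneg (vC ζ), norm_nonneg (xC ζ)]
  have h2 : jz ζ * jz ζ ^ (s / 2 - 1) = JJ s ζ := by
    unfold JJ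
    nth_rewrite 1 [← Real.rpow_one (jz ζ)]
    rw [← Real.rpow_add h0]; congr 1; ring
  have h3 : 0 ≤ jz ζ ^ (s / 2 - 1) := (Real.rpow_pos_of_pos h0 _).le
  rw [abs_mul, abs_mul, abs_mul, abs_of_nonneg h3, abs_two, abs_div, abs_two]
  calc _ = |s| * (|(inner ℝ (vC ζ) (xC ζ) : ℝ)| * jz ζ ^ (s / 2 - 1)) := by ring
    _ ≤ |s| * (jz ζ * jz ζ ^ (s / 2 - 1)) := by gcongr
    _ = _ := by rw [h2]

section
variable {σ : ℝ} {F : Z n → ℝ} {CF : ℝ}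

lemma ker_f2 (hσ : 0 < σ) (hF : ∀ ζ, |F ζ - lam σ ζ| ≤ CF) (s : ℝ) : ∃ N : ℕ, ∀ ζ t : Z n,
    |1 * (lam σ (ζ - t) * JJ s (ζ - t)) - JJ s ζ * F (ζ - t)|
      ≤ (|s| + CF) * (1 + ‖t‖) ^ N * (er σ (ζ - t) * JJ s (ζ - t)) := by
  obtain ⟨N1, H1⟩ := JJ_diff (n := n) s
  obtain ⟨N2, H2⟩ := JJ_peetre (n := n) s
  refine ⟨N1 + N2, fun ζ t => ?_⟩
  have h1 := H1 ζ t
  have h2 := H2 ζ t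
  have h3 := hF (ζ - t)
  have hCF : 0 ≤ CF := (abs_nonneg _).trans h3
  have t0 : (1:ℝ) ≤ 1 + ‖t‖ := by linarith [norm_nonneg t]
  have T1 : (1:ℝ) ≤ (1 + ‖t‖) ^ N1 := one_le_pow₀ t0
  have T2 : (1:ℝ) ≤ (1 + ‖t‖) ^ N2 := one_le_pow₀ t0
  have J0 := JJ_pos s (ζ - t)
  have J1 := JJ_pos s ζ
  have l0 := one_le_lam hσ (ζ - t)
  have e0 : lam σ (ζ - t) * jv (ζ - t) ^ (-1/2:ℝ) = jv (ζ - t) ^ (σ - 1/2) := by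
    unfold lam; rw [← Real.rpow_add (jv_pos _)]; congr 1; ring
  have q0 : 0 < jv (ζ - t) ^ (-1/2:ℝ) := Real.rpow_pos_of_pos (jv_pos _) _
  have p0 : 0 < jv (ζ - t) ^ (σ - 1/2) := Real.rpow_pos_of_pos (jv_pos _) _
  rw [pow_add]
  unfold er
  set l := lam σ (ζ - t)
  set J' := JJ s (ζ - t)
  set J := JJ s ζ
  set q := jv (ζ - t) ^ (-1/2:ℝ)
  set e := jv (ζ - t) ^ (σ - 1/2)
  set A := (1 + ‖t‖) ^ N1
  set B := (1 + ‖t‖) ^ N2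
  have id : 1 * (l * J') - J * F (ζ - t) = -(l * (J - J') + J * (F (ζ - t) - l)) := by ring
  rw [id, abs_neg]
  refine (abs_add_le _ _).trans ?_
  rw [abs_mul, abs_mul, abs_of_pos (by linarith : 0 < l), abs_of_pos J1]
  have b1 : l * |J - J'| ≤ |s| * A * (J' * e) := by
    calc _ ≤ l * (|s| * A * (J' * q)) := by gcongr
      _ = |s| * A * (J' * (l * q)) := by ring
      _ = _ := by rw [e0]
  have b2 : J * |F (ζ - t) - l| ≤ (B * J') * CF := by gcongr
  have b3 : |s| * A * (J' * e) ≤ |s| * (A * B) * ((1 + e) * J') := by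
    have : |s| * A * (J' * e) ≤ |s| * (A * B) * (J' * (1 + e)) := by
      gcongr
      · nlinarith
      · linarith
    linarith
  have b4 : (B * J') * CF ≤ CF * (A * B) * ((1 + e) * J') := by
    have : CF * (1 * B) * (1 * J') ≤ CF * (A * B) * ((1 + e) * J') := by
      gcongr
      linarith
    linarith
  linarith

lemma ker_f3 (hσ : 0 < σ) (hF : ∀ ζ, |F ζ - lam σ ζ| ≤ CF) (s : ℝ) : ∃ N : ℕ, ∀ ζ t : Z n,
    |(lam σ ζ * JJ s ζ) * 1 - JJ s ζ * F (ζ - t)|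
      ≤ (2 * σ + CF) * (1 + ‖t‖) ^ N * (er σ (ζ - t) * JJ s (ζ - t)) := by
  obtain ⟨N1, H1⟩ := lam_diff (n := n) hσ
  obtain ⟨N2, H2⟩ := JJ_peetre (n := n) s
  refine ⟨N1 + N2, fun ζ t => ?_⟩
  have h1 := H1 ζ t
  have h2 := H2 ζ t
  have h3 := hF (ζ - t)
  have hCF : 0 ≤ CF := (abs_nonneg _).trans h3
  have t0 : (1:ℝ) ≤ 1 + ‖t‖ := by linarith [norm_nonneg t]
  have T1 : (1:ℝ) ≤ (1 + ‖t‖) ^ N1 := one_le_pow₀ t0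
  have T2 : (1:ℝ) ≤ (1 + ‖t‖) ^ N2 := one_le_pow₀ t0
  have J0 := JJ_pos s (ζ - t)
  have J1 := JJ_pos s ζ
  have p0 : 0 < jv (ζ - t) ^ (σ - 1/2) := Real.rpow_pos_of_pos (jv_pos _) _
  rw [pow_add]
  unfold er
  set l := lam σ (ζ - t)
  set J' := JJ s (ζ - t)
  set J := JJ s ζ
  set e := jv (ζ - t) ^ (σ - 1/2)
  set A := (1 + ‖t‖) ^ N1
  set B := (1 + ‖t‖) ^ N2
  have id : lam σ ζ * J * 1 - J * F (ζ - t) = J * ((lam σ ζ - l) - (F (ζ - t) - l)) := by ring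
  rw [id, abs_mul, abs_of_pos J1]
  have b1 : |(lam σ ζ - l) - (F (ζ - t) - l)| ≤ (2 * σ + CF) * A * (1 + e) := by
    refine (abs_sub _ _).trans ?_
    have : 2 * σ * A * e ≤ 2 * σ * A * (1 + e) := by gcongr; linarith
    have : CF * 1 * 1 ≤ CF * A * (1 + e) := by gcongr; linarith
    linarith
  calc _ ≤ (B * J') * ((2 * σ + CF) * A * (1 + e)) := by gcongr
    _ = _ := by ring

lemma ker_F (hσ : 0 < σ) (hF : ∀ ζ, |F ζ - lam σ ζ| ≤ CF) (s : ℝ) : ∃ N : ℕ, ∀ ζ t : Z n,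
    |JJ s ζ * F (ζ - t)| ≤ (1 + CF) * (1 + ‖t‖) ^ N * (lam σ (ζ - t) * JJ s (ζ - t)) := by
  obtain ⟨N2, H2⟩ := JJ_peetre (n := n) s
  refine ⟨N2, fun ζ t => ?_⟩
  have h2 := H2 ζ t
  have h3 := hF (ζ - t)
  have hCF : 0 ≤ CF := (abs_nonneg _).trans h3
  have J0 := JJ_pos s (ζ - t)
  have J1 := JJ_pos s ζ
  have l0 := one_le_lam hσ (ζ - t)
  have : |F (ζ - t)| ≤ (1 + CF) * lam σ (ζ - t) := by
    rw [abs_le] at h3 ⊢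
    constructor <;> nlinarith
  rw [abs_mul, abs_of_pos J1]
  calc _ ≤ ((1 + ‖t‖) ^ N2 * JJ s (ζ - t)) * ((1 + CF) * lam σ (ζ - t)) := by gcongr
    _ = _ := by ring

lemma norm_sq4 (a b c d : ℂ) : ‖a + b + c + d‖ ^ 2 ≤ 4 * (‖a‖ ^ 2 + ‖b‖ ^ 2 + ‖c‖ ^ 2 + ‖d‖ ^ 2) := by
  have h := (norm_add_le (a + b + c) d).trans
    (add_le_add ((norm_add_le (a + b) c).trans (add_le_add (norm_add_le a b) le_rfl)) le_rfl)
  have h2 : ‖a + b + c + d‖ ^ 2 ≤ (‖a‖ + ‖b‖ + ‖c‖ + ‖d‖) ^ 2 := by gcongr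
  nlinarith [sq_nonneg (‖a‖ - ‖b‖), sq_nonneg (‖a‖ - ‖c‖), sq_nonneg (‖a‖ - ‖d‖),
    sq_nonneg (‖b‖ - ‖c‖), sq_nonneg (‖b‖ - ‖d‖), sq_nonneg (‖c‖ - ‖d‖)]

lemma int_sq4 (f f0 f1 f2 f3 : 𝓢(Z n, ℂ)) (h : ∀ ζ, f ζ = f0 ζ + f1 ζ + f2 ζ + f3 ζ) :
    ∫ ζ, ‖f ζ‖ ^ 2 ≤ 4 * ((∫ ζ, ‖f0 ζ‖ ^ 2) + (∫ ζ, ‖f1 ζ‖ ^ 2) + (∫ ζ, ‖f2 ζ‖ ^ 2)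
      + (∫ ζ, ‖f3 ζ‖ ^ 2)) := by
  have i0 := integrable_sq f0
  have i1 := integrable_sq f1
  have i2 := integrable_sq f2
  have i3 := integrable_sq f3
  have i01 : Integrable (fun ζ => ‖f0 ζ‖ ^ 2 + ‖f1 ζ‖ ^ 2) := i0.add i1
  have i012 : Integrable (fun ζ => ‖f0 ζ‖ ^ 2 + ‖f1 ζ‖ ^ 2 + ‖f2 ζ‖ ^ 2) := i01.add i2
  have i0123 : Integrable (fun ζ => ‖f0 ζ‖ ^ 2 + ‖f1 ζ‖ ^ 2 + ‖f2 ζ‖ ^ 2 + ‖f3 ζ‖ ^ 2) := i012.add i3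
  rw [← integral_add i0 i1, ← integral_add i01 i2, ← integral_add i012 i3,
    ← integral_const_mul]
  refine integral_mono (integrable_sq f) (i0123.const_mul 4) fun ζ => ?_
  simp only [h ζ]
  exact norm_sq4 _ _ _ _

end

end Hypo

namespace Hypo

open Function

lemma wI_one (V : 𝓢(Z n, ℂ)) : wI (fun _ => 1) V = ∫ ζ, ‖V ζ‖ ^ 2 := by
  unfold wI; simp

/-- the `H^s` version of the core estimate -/
theorem main1 {σ a0 : ℝ} (hσ : 0 < σ) (hσ1 : σ < 1) (ha : 0 < a0) {b : 𝓢(Z n, ℂ)} {b' : Z n → ℝ}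
    (hb : ∀ x, b x = b' x) (hb0 : ∀ x, 0 ≤ b' x) (κ : 𝓢(Z n, ℂ)) {F : Z n → ℝ}
    (tF : F.HasTemperateGrowth) {CF : ℝ} (hF : ∀ ζ, |F ζ - lam σ ζ| ≤ CF) (s : ℝ) :
    ∃ C : ℝ, 0 < C ∧ ∀ U g : 𝓢(Z n, ℂ), conv κ U = U →
      (∀ ζ, Dop U ζ + (a0 : ℂ) * conv κ (mu F U) ζ + conv (𝓕 b) (mu F U) ζ = conv κ g ζ) →
      wI (fun ζ => lam σ ζ ^ 2) (mu (JJ s) U) + wI (fun ζ => rr σ ζ ^ 2) (mu (JJ s) U)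
        + wI (fun _ => 1) (mu (JJ s) (Dop U))
        ≤ C * (wI (fun _ => 1) (mu (JJ s) g) + wI (fun _ => 1) (mu (JJ s) U)) := by
  have hCF : 0 ≤ CF := (abs_nonneg _).trans (hF 0)
  have tJ := JJ_tg (n := n) s
  have tl := lam_tg (n := n) σ
  have te := er_tg (n := n) σ
  have t1 : (fun _ : Z n => (1:ℝ)).HasTemperateGrowth := HasTemperateGrowth.const (1:ℝ)
  obtain ⟨C0, hC0, H0⟩ := core hσ hσ1 ha hb hb0
  obtain ⟨Ng, hNg⟩ := JJ_peetre (n := n) s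
  obtain ⟨N2, hN2⟩ := ker_f2 hσ hF s
  obtain ⟨N3, hN3⟩ := ker_f3 hσ hF s
  obtain ⟨N4, hN4⟩ := ker_F hσ hF s
  obtain ⟨Cg, hCg, Hg⟩ := conv_bound κ Ng (zero_le_one' ℝ)
  obtain ⟨C2, hC2, H2⟩ := comm_bound (𝓕 b) N2 (c := |s| + CF) (by positivity)
  obtain ⟨C3, hC3, H3⟩ := comm_bound κ N3 (c := 2 * σ + CF) (by positivity)
  obtain ⟨C4, hC4, H4⟩ := conv_bound κ N4 (c := 1 + CF) (by positivity)
  obtain ⟨C5, hC5, H5⟩ := conv_bound (𝓕 b) N4 (c := 1 + CF) (by positivity)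
  -- the constants of absorption
  set D := C2 + a0 ^ 2 * C3 with hD
  have hD0 : 0 < D := by positivity
  set δ := (16 * C0 * D)⁻¹ with hδ
  have hδ0 : 0 < δ := by positivity
  set L := 2 + 2 * (δ⁻¹) ^ (2 * σ) with hL
  have hL0 : 0 < L := by positivity
  set A := 2 * C0 * (4 * (Cg + s ^ 2 + D * L) + 1) with hA
  have hA0 : 0 < A := by positivity
  set B := 4 * (Cg + a0 ^ 2 * C4 * A + C5 * A) with hB
  have hB0 : 0 < B := by positivity
  refine ⟨A + B, by positivity, fun U g hU heq => ?_⟩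
  set W := mu (JJ s) U with hW
  have hJ2 : ∀ (p : Z n → ℝ) (V : 𝓢(Z n, ℂ)), wI (fun ζ => (p ζ * JJ s ζ) ^ 2) V =
      wI (fun ζ => p ζ ^ 2) (mu (JJ s) V) := by
    intro p V
    rw [wI_mu tJ]; congr 1; ext ζ; ring
  have hJ1 : ∀ (V : 𝓢(Z n, ℂ)), wI (fun ζ => JJ s ζ ^ 2) V = wI (fun _ => 1) (mu (JJ s) V) := by
    intro V
    rw [wI_mu tJ]; congr 1; ext ζ; ring
  -- the four pieces
  set f0 := mu (JJ s) (conv κ g) with hf0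
  set f1 := Dop W - mu (JJ s) (Dop U) with hf1
  set f2 := conv (𝓕 b) (mu (lam σ) W) - mu (JJ s) (conv (𝓕 b) (mu F U)) with hf2
  set f3 := (a0 : ℂ) • (mu (lam σ) W - mu (JJ s) (conv κ (mu F U))) with hf3
  set Φ := Dop W + (a0 : ℂ) • mu (lam σ) W + conv (𝓕 b) (mu (lam σ) W) with hΦ
  have hsum : ∀ ζ, Φ ζ = f0 ζ + f1 ζ + f2 ζ + f3 ζ := by
    intro ζ
    simp only [hΦ, hf0, hf1, hf2, hf3, add_apply, sub_apply, smul_apply, smul_eq_mul]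
    rw [mu_apply tJ (conv κ g), mu_apply tJ (Dop U), mu_apply tJ (conv (𝓕 b) (mu F U)),
      mu_apply tJ (conv κ (mu F U)), ← heq ζ]
    ring
  have B0 : ∫ ζ, ‖f0 ζ‖ ^ 2 ≤ Cg * wI (fun _ => 1) (mu (JJ s) g) := by
    have := Hg g (JJ s) (fun _ => 1) (JJ s) tJ t1 tJ (fun ζ t => by
      rw [mul_one, one_mul, abs_of_pos (JJ_pos s ζ)]; exact hNg ζ t)
    rwa [mu_one, hJ1] at this
  have B1 : ∫ ζ, ‖f1 ζ‖ ^ 2 ≤ s ^ 2 * wI (fun _ => 1) W := by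
    rw [wI_one, ← integral_const_mul]
    refine integral_mono (integrable_sq f1) ((integrable_sq W).const_mul _) fun ζ => ?_
    have e : f1 ζ = - ((XX (JJ s) ζ : ℂ) * U ζ) := by
      rw [hf1, sub_apply, hW, Dop_mu tJ, mu_apply tJ]; ring
    have e2 : ‖f1 ζ‖ ≤ |s| * ‖W ζ‖ := by
      rw [e, norm_neg, norm_mul, Complex.norm_real, Real.norm_eq_abs, hW, norm_mu tJ,
        abs_of_pos (JJ_pos s ζ), ← mul_assoc]
      gcongr
      exact XX_JJ s ζ
    calc ‖f1 ζ‖ ^ 2 ≤ (|s| * ‖W ζ‖) ^ 2 := by gcongr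
      _ = _ := by rw [mul_pow, sq_abs]
  have B2 : ∫ ζ, ‖f2 ζ‖ ^ 2 ≤ C2 * wI (fun ζ => er σ ζ ^ 2) W := by
    have := H2 U (fun _ => 1) (fun ζ => lam σ ζ * JJ s ζ) (JJ s) F (fun ζ => er σ ζ * JJ s ζ)
      t1 (tg_mul tl tJ) tJ tF (tg_mul te tJ) hN2
    rw [mu_one, hJ2, ← mu_mu tl tJ] at this
    simpa only [hf2, sub_apply] using this
  have B3 : ∫ ζ, ‖f3 ζ‖ ^ 2 ≤ a0 ^ 2 * (C3 * wI (fun ζ => er σ ζ ^ 2) W) := by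
    have := H3 U (fun ζ => lam σ ζ * JJ s ζ) (fun _ => 1) (JJ s) F (fun ζ => er σ ζ * JJ s ζ)
      (tg_mul tl tJ) t1 tJ tF (tg_mul te tJ) hN3
    rw [mu_one, hU, hJ2, ← mu_mu tl tJ] at this
    have e : ∫ ζ, ‖f3 ζ‖ ^ 2 = a0 ^ 2 * ∫ ζ, ‖mu (lam σ) W ζ - mu (JJ s) (conv κ (mu F U)) ζ‖ ^ 2 := by
      rw [← integral_const_mul]
      congr 1; ext ζ
      simp only [hf3, smul_apply, sub_apply, smul_eq_mul]
      rw [norm_mul, Complex.norm_real, mul_pow, Real.norm_eq_abs, sq_abs]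
    rw [e]
    gcongr
  have Be : wI (fun ζ => er σ ζ ^ 2) W ≤ (2 * δ) * wI (fun ζ => lam σ ζ ^ 2) W
      + L * wI (fun _ => 1) W :=
    wI_le_of2 (sq_tg te) (sq_tg tl) t1 (fun ζ => er_sq hσ hδ0 ζ)
  have BΦ := int_sq4 Φ f0 f1 f2 f3 hsum
  have BC := H0 W Φ (fun ζ => by simp only [hΦ, add_apply, smul_apply, smul_eq_mul])
  have G0 : 0 ≤ wI (fun _ => 1) (mu (JJ s) g) := wI_nonneg (fun _ => zero_le_one) _
  have W0 : 0 ≤ wI (fun _ => 1) W := wI_nonneg (fun _ => zero_le_one) _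
  have X0 : 0 ≤ wI (fun ζ => lam σ ζ ^ 2) W := wI_nonneg (fun _ => sq_nonneg _) _
  have Y0 : 0 ≤ wI (fun ζ => rr σ ζ ^ 2) W := wI_nonneg (fun _ => sq_nonneg _) _
  have E0 : 0 ≤ wI (fun ζ => er σ ζ ^ 2) W := wI_nonneg (fun _ => sq_nonneg _) _
  -- the bound of `J D U`
  have D1 : ∫ ζ, ‖mu (JJ s) (conv κ (mu F U)) ζ‖ ^ 2 ≤ C4 * wI (fun ζ => lam σ ζ ^ 2) W := by
    have := H4 U (JJ s) F (fun ζ => lam σ ζ * JJ s ζ) tJ tF (tg_mul tl tJ) hN4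
    rwa [hJ2] at this
  have D2 : ∫ ζ, ‖mu (JJ s) (conv (𝓕 b) (mu F U)) ζ‖ ^ 2 ≤ C5 * wI (fun ζ => lam σ ζ ^ 2) W := by
    have := H5 U (JJ s) F (fun ζ => lam σ ζ * JJ s ζ) tJ tF (tg_mul tl tJ) hN4
    rwa [hJ2] at this
  have D3 := int_sq4 (mu (JJ s) (Dop U)) f0 (-((a0:ℂ) • mu (JJ s) (conv κ (mu F U))))
    (- mu (JJ s) (conv (𝓕 b) (mu F U))) 0 (fun ζ => by
      simp only [hf0, neg_apply, smul_apply, smul_eq_mul, zero_apply]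
      rw [mu_apply tJ (conv κ g), mu_apply tJ (Dop U), mu_apply tJ (conv (𝓕 b) (mu F U)),
        mu_apply tJ (conv κ (mu F U)), ← heq ζ]
      ring)
  have D4 : ∫ ζ, ‖(-((a0:ℂ) • mu (JJ s) (conv κ (mu F U)))) ζ‖ ^ 2 =
      a0 ^ 2 * ∫ ζ, ‖mu (JJ s) (conv κ (mu F U)) ζ‖ ^ 2 := by
    rw [← integral_const_mul]
    congr 1; ext ζ
    simp only [neg_apply, smul_apply, smul_eq_mul]
    rw [norm_neg, norm_mul, Complex.norm_real, mul_pow, Real.norm_eq_abs, sq_abs]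
  have D5 : ∫ ζ, ‖(- mu (JJ s) (conv (𝓕 b) (mu F U))) ζ‖ ^ 2 =
      ∫ ζ, ‖mu (JJ s) (conv (𝓕 b) (mu F U)) ζ‖ ^ 2 := by
    simp only [neg_apply, norm_neg]
  have D6 : ∫ ζ, ‖(0 : 𝓢(Z n, ℂ)) ζ‖ ^ 2 = 0 := by simp
  rw [D4, D5, D6, ← wI_one] at D3
  set X := wI (fun ζ => lam σ ζ ^ 2) W
  set Y := wI (fun ζ => rr σ ζ ^ 2) W
  set N := wI (fun _ => 1) W
  set G := wI (fun _ => 1) (mu (JJ s) g)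
  set Er := wI (fun ζ => er σ ζ ^ 2) W
  have K1 : ∫ ζ, ‖Φ ζ‖ ^ 2 ≤ 4 * (Cg * G + s ^ 2 * N + D * (2 * δ * X + L * N)) := by
    have : D * Er ≤ D * (2 * δ * X + L * N) := by gcongr
    rw [hD] at this ⊢
    linarith
  have K2 : X + Y ≤ C0 * (4 * (Cg * G + s ^ 2 * N + D * (2 * δ * X + L * N)) + N) := by
    refine BC.trans ?_
    gcongr
  have K3 : C0 * (4 * (D * (2 * δ * X))) = X / 2 := by
    rw [hδ]; field_simp; ring
  have K4 : X + Y ≤ A * (G + N) := by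
    have : X + Y ≤ 2 * C0 * (4 * (Cg * G + s ^ 2 * N + D * (L * N)) + N) := by linarith
    refine this.trans ?_
    rw [hA, mul_assoc _ _ (G + N)]
    gcongr
    have := mul_nonneg hCg.le W0
    have := mul_nonneg (sq_nonneg s) G0
    have := mul_nonneg (mul_nonneg hD0.le hL0.le) G0
    linarith
  have K5 : X ≤ A * (G + N) := by linarith
  have K6 : wI (fun _ => 1) (mu (JJ s) (Dop U)) ≤ B * (G + N) := by
    have h1 : a0 ^ 2 * ∫ ζ, ‖mu (JJ s) (conv κ (mu F U)) ζ‖ ^ 2 ≤ a0 ^ 2 * (C4 * (A * (G + N))) := by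
      gcongr
      refine D1.trans ?_
      gcongr
    have h2 : ∫ ζ, ‖mu (JJ s) (conv (𝓕 b) (mu F U)) ζ‖ ^ 2 ≤ C5 * (A * (G + N)) := by
      refine D2.trans ?_
      gcongr
    have := mul_nonneg hCg.le W0
    rw [hB]
    linarith
  linarith

end Hypo

namespace Hypo

open Function

/-- the weight on the left-hand side -/
def lw (σ : ℝ) (ζ : Z n) : ℝ := 1 + |tC ζ| ^ (2 * σ / (2 * σ + 1)) + ‖xC ζ‖ ^ (2 * σ / (2 * σ + 1))
        + ‖vC ζ‖ ^ (2 * σ)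

lemma norm_rpow_le {x e : ℝ} (hx : 0 ≤ x) (he : 0 ≤ e) : x ^ (2 * e) ≤ (1 + x ^ 2) ^ e := by
  rw [Real.rpow_mul hx]
  apply Real.rpow_le_rpow (by positivity) _ he
  rw [Real.rpow_two]; linarith

lemma tau_bound {σ : ℝ} (hσ : 0 < σ) (ζ : Z n) {A D S : ℝ} (hA : 0 ≤ A) (hD : 0 ≤ D) (hS : 0 ≤ S)
    (h : |tC ζ| * A ≤ D + ‖xC ζ‖ * S) :
    |tC ζ| ^ (2 * σ / (2 * σ + 1)) * A ≤ rr σ ζ * A + D + rr σ ζ * S := by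
  set p := 2 * σ / (2 * σ + 1) with hp
  have hp0 : 0 < p := by positivity
  have hp1 : p < 1 := by rw [hp, div_lt_one (by positivity)]; linarith
  set y := jx ζ ^ (1/2:ℝ) with hy
  have hy1 : 1 ≤ y := one_le_half (one_le_jx ζ)
  have hr : rr σ ζ = y ^ p := by
    rw [hy, half_rpow (one_le_jx ζ), rr]; congr 1; rw [hp, al]; field_simp
  have hxy : ‖xC ζ‖ ≤ y := by
    rw [hy, ← Real.sqrt_eq_rpow]
    apply Real.le_sqrt_of_sq_le; unfold jx; linarith
  have hyp : 0 ≤ y ^ p := by positivity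
  rw [hr]
  rcases le_total |tC ζ| y with hc | hc
  · have : |tC ζ| ^ p ≤ y ^ p := Real.rpow_le_rpow (abs_nonneg _) hc hp0.le
    have := mul_le_mul_of_nonneg_right this hA
    have := mul_nonneg hyp hS
    linarith
  · have ht0 : 0 < |tC ζ| := by linarith
    have e1 : |tC ζ| ^ p = |tC ζ| ^ (p - 1) * |tC ζ| := by
      nth_rewrite 3 [← Real.rpow_one |tC ζ|]
      rw [← Real.rpow_add ht0]; congr 1; ring
    have e2 : |tC ζ| ^ (p - 1) ≤ 1 := Real.rpow_le_one_of_one_le_of_nonpos (by linarith) (by linarith)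
    have e3 : |tC ζ| ^ (p - 1) ≤ y ^ (p - 1) :=
      Real.rpow_le_rpow_of_nonpos (by linarith) hc (by linarith)
    have e4 : y ^ (p - 1) * y = y ^ p := by
      nth_rewrite 2 [← Real.rpow_one y]
      rw [← Real.rpow_add (by linarith)]; congr 1; ring
    have e0 : 0 ≤ |tC ζ| ^ (p - 1) := by positivity
    calc |tC ζ| ^ p * A = |tC ζ| ^ (p - 1) * (|tC ζ| * A) := by rw [e1]; ring
      _ ≤ |tC ζ| ^ (p - 1) * (D + ‖xC ζ‖ * S) := by gcongr
      _ = |tC ζ| ^ (p - 1) * D + |tC ζ| ^ (p - 1) * (‖xC ζ‖ * S) := by ring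
      _ ≤ 1 * D + y ^ (p - 1) * (y * S) := by gcongr
      _ = D + y ^ p * S := by rw [← e4]; ring
      _ ≤ _ := by have := mul_nonneg hyp hA; linarith

lemma real_sq4 (x y z v : ℝ) :
    (2 * (x + y + z + v)) ^ 2 ≤ 16 * (x ^ 2 + y ^ 2 + z ^ 2 + v ^ 2) := by
  nlinarith [sq_nonneg (x - y), sq_nonneg (x - z), sq_nonneg (x - v), sq_nonneg (y - z),
      sq_nonneg (y - v), sq_nonneg (z - v)]

set_option maxHeartbeats 1000000 in
/-- the complete estimate on the Fourier side -/
theorem main2 {σ a0 : ℝ} (hσ : 0 < σ) (hσ1 : σ < 1) (ha : 0 < a0) {b : 𝓢(Z n, ℂ)} {b' : Z n → ℝ}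
    (hb : ∀ x, b x = b' x) (hb0 : ∀ x, 0 ≤ b' x) (κ : 𝓢(Z n, ℂ)) {F : Z n → ℝ}
    (tF : F.HasTemperateGrowth) {CF : ℝ} (hF : ∀ ζ, |F ζ - lam σ ζ| ≤ CF) (s : ℝ)
    (θ : Fin n → 𝓢(Z n, ℂ)) :
    ∃ C : ℝ, 0 < C ∧ ∀ U g : 𝓢(Z n, ℂ), conv κ U = U →
      (∀ ζ, Dop U ζ + (a0 : ℂ) * conv κ (mu F U) ζ + conv (𝓕 b) (mu F U) ζ = conv κ g ζ) →
      (∀ i ζ, fderiv ℝ U ζ (eV i) = conv (θ i) U ζ) →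
      ∃ R : Z n → ℝ, Integrable R ∧ (∀ ζ, ‖((JJ s ζ * lw σ ζ : ℝ) : ℂ) * U ζ‖ ^ 2 ≤ R ζ) ∧
        ∫ ζ, R ζ ≤ C * (wI (fun _ => 1) (mu (JJ s) g) + wI (fun _ => 1) (mu (JJ s) U)) := by
  have tJ := JJ_tg (n := n) s
  have tl := lam_tg (n := n) σ
  have tr := rr_tg (n := n) σ
  have t1 : (fun _ : Z n => (1:ℝ)).HasTemperateGrowth := HasTemperateGrowth.const (1:ℝ)
  obtain ⟨C0, hC0, H0⟩ := main1 hσ hσ1 ha hb hb0 κ tF hF s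
  obtain ⟨N1, hN1⟩ := JJ_peetre (n := n) s
  obtain ⟨N2, hN2⟩ := rr_peetre (n := n) (σ := σ)
  have hk : ∀ ζ t : Z n, |(rr σ ζ * JJ s ζ) * 1|
      ≤ 1 * (1 + ‖t‖) ^ (N2 + N1) * (rr σ (ζ - t) * JJ s (ζ - t)) := by
    intro ζ t
    have h1 := hN1 ζ t
    have h2 := hN2 ζ t
    have r0 := one_le_rr hσ ζ
    have r1 := one_le_rr hσ (ζ - t)
    have j0 := JJ_pos s ζ
    have j1 := JJ_pos s (ζ - t)
    rw [mul_one, abs_of_nonneg (by positivity), pow_add]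
    calc _ ≤ ((1 + ‖t‖) ^ N2 * rr σ (ζ - t)) * ((1 + ‖t‖) ^ N1 * JJ s (ζ - t)) := by gcongr
      _ = _ := by ring
  have := fun i => conv_bound (θ i) (N2 + N1) (zero_le_one' ℝ)
  choose Cθ hCθ Hθ using this
  set Q := ∑ i, Cθ i with hQ
  have hQ0 : 0 ≤ Q := Finset.sum_nonneg fun i _ => (hCθ i).le
  refine ⟨16 * (C0 + n * (Q * C0)), by positivity, fun U g hU heq hder => ?_⟩
  have K := H0 U g hU heq
  set W := mu (JJ s) U with hW
  set V := fun i => mu (fun ζ => rr σ ζ * JJ s ζ) (conv (θ i) U) with hV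
  have hVb : ∀ i, ∫ ζ, ‖V i ζ‖ ^ 2 ≤ Cθ i * wI (fun ζ => rr σ ζ ^ 2) W := by
    intro i
    have := Hθ i U (fun ζ => rr σ ζ * JJ s ζ) (fun _ => 1) (fun ζ => rr σ ζ * JJ s ζ)
      (tg_mul tr tJ) t1 (tg_mul tr tJ) hk
    rw [mu_one] at this
    refine this.trans (le_of_eq ?_)
    rw [hW, wI_mu tJ]; congr 2; ext ζ; ring
  have iX := integrable_w (sq_tg tl) W
  have iY := integrable_w (sq_tg tr) W
  have iD := integrable_sq (mu (JJ s) (Dop U))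
  have iV : Integrable (fun ζ => ∑ i, ‖V i ζ‖ ^ 2) :=
    integrable_finsetSum _ fun i _ => integrable_sq (V i)
  have iXY : Integrable (fun ζ => lam σ ζ ^ 2 * ‖W ζ‖ ^ 2 + rr σ ζ ^ 2 * ‖W ζ‖ ^ 2) := iX.add iY
  have iXYD : Integrable (fun ζ => lam σ ζ ^ 2 * ‖W ζ‖ ^ 2 + rr σ ζ ^ 2 * ‖W ζ‖ ^ 2
    + ‖mu (JJ s) (Dop U) ζ‖ ^ 2) := iXY.add iD
  have iall : Integrable (fun ζ => lam σ ζ ^ 2 * ‖W ζ‖ ^ 2 + rr σ ζ ^ 2 * ‖W ζ‖ ^ 2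
    + ‖mu (JJ s) (Dop U) ζ‖ ^ 2 + n * ∑ i, ‖V i ζ‖ ^ 2) := iXYD.add (iV.const_mul _)
  refine ⟨_, iall.const_mul 16, fun ζ => ?_, ?_⟩
  · have j0 := JJ_pos s ζ
    have r0 := one_le_rr hσ ζ
    have l0 := one_le_lam hσ ζ
    have hWn : ‖W ζ‖ = JJ s ζ * ‖U ζ‖ := by rw [hW, norm_mu tJ, abs_of_pos j0]
    have hDn : ‖mu (JJ s) (Dop U) ζ‖ = JJ s ζ * ‖Dop U ζ‖ := by rw [norm_mu tJ, abs_of_pos j0]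
    have hVn : ∑ i, ‖V i ζ‖ = JJ s ζ * (rr σ ζ * ∑ i, ‖conv (θ i) U ζ‖) := by
      rw [Finset.mul_sum, Finset.mul_sum]
      refine Finset.sum_congr rfl fun i _ => ?_
      rw [hV]
      simp only
      rw [norm_mu (tg_mul tr tJ), abs_of_pos (by positivity)]; ring
    have htau : |tC ζ| * ‖U ζ‖ ≤ ‖Dop U ζ‖ + ‖xC ζ‖ * ∑ i, ‖conv (θ i) U ζ‖ := by
      have e : (2 * π * Complex.I) * ((tC ζ : ℂ) * U ζ) = Dop U ζ + ∑ i, (xC ζ i : ℂ) * conv (θ i) U ζ := by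
        rw [Dop_apply]; simp_rw [hder]; ring
      have e1 : ‖(2 * π * Complex.I) * ((tC ζ : ℂ) * U ζ)‖ = 2 * π * (|tC ζ| * ‖U ζ‖) := by
        simp [abs_of_pos Real.pi_pos]
      have e2 : ‖Dop U ζ + ∑ i, (xC ζ i : ℂ) * conv (θ i) U ζ‖ ≤
          ‖Dop U ζ‖ + ‖xC ζ‖ * ∑ i, ‖conv (θ i) U ζ‖ := by
        refine (norm_add_le _ _).trans ?_
        gcongr
        rw [Finset.mul_sum]
        refine norm_sum_le_of_le _ fun i _ => ?_
        rw [norm_mul, Complex.norm_real]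
        gcongr
        exact PiLp.norm_apply_le _ i
      rw [← e, e1] at e2
      have : 0 ≤ |tC ζ| * ‖U ζ‖ := by positivity
      nlinarith [Real.pi_gt_three]
    have hS0 : 0 ≤ ∑ i, ‖conv (θ i) U ζ‖ := Finset.sum_nonneg fun _ _ => norm_nonneg _
    have T := tau_bound hσ ζ (norm_nonneg (U ζ)) (norm_nonneg (Dop U ζ)) hS0 htau
    have hx : ‖xC ζ‖ ^ (2 * σ / (2 * σ + 1)) ≤ rr σ ζ := by
      have := norm_rpow_le (norm_nonneg (xC ζ)) (mul_pos hσ (al_pos hσ)).le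
      have e : 2 * (σ * al σ) = 2 * σ / (2 * σ + 1) := by rw [al]; field_simp
      rwa [e] at this
    have hv : ‖vC ζ‖ ^ (2 * σ) ≤ lam σ ζ := norm_rpow_le (norm_nonneg (vC ζ)) hσ.le
    have hlw0 : 0 ≤ lw σ ζ := by unfold lw; positivity
    have main : JJ s ζ * lw σ ζ * ‖U ζ‖ ≤
        2 * (lam σ ζ * ‖W ζ‖ + rr σ ζ * ‖W ζ‖ + ‖mu (JJ s) (Dop U) ζ‖ + ∑ i, ‖V i ζ‖) := by
      rw [hWn, hDn, hVn]
      have : lw σ ζ * ‖U ζ‖ ≤ 2 * (lam σ ζ * ‖U ζ‖ + rr σ ζ * ‖U ζ‖ + ‖Dop U ζ‖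
          + rr σ ζ * ∑ i, ‖conv (θ i) U ζ‖) := by
        unfold lw
        have u0 := norm_nonneg (U ζ)
        have a1 := mul_le_mul_of_nonneg_right hx u0
        have a2 := mul_le_mul_of_nonneg_right hv u0
        have a3 := mul_le_mul_of_nonneg_right l0 u0
        have a4 : 0 ≤ rr σ ζ * ∑ i, ‖conv (θ i) U ζ‖ := by positivity
        have a5 := norm_nonneg (Dop U ζ)
        have a6 : 0 ≤ lam σ ζ * ‖U ζ‖ := by positivity
        linarith
      have := mul_le_mul_of_nonneg_left this j0.le
      linarith
    have hsq : (∑ i, ‖V i ζ‖) ^ 2 ≤ n * ∑ i, ‖V i ζ‖ ^ 2 := by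
      simpa using sq_sum_le_card_mul_sum_sq (s := Finset.univ) (f := fun i => ‖V i ζ‖)
    rw [norm_mul, Complex.norm_real, Real.norm_of_nonneg (by positivity)]
    have m2 : (JJ s ζ * lw σ ζ * ‖U ζ‖) ^ 2 ≤
        (2 * (lam σ ζ * ‖W ζ‖ + rr σ ζ * ‖W ζ‖ + ‖mu (JJ s) (Dop U) ζ‖ + ∑ i, ‖V i ζ‖)) ^ 2 := by
      gcongr
    refine m2.trans ?_
    set x := lam σ ζ * ‖W ζ‖ with hx'
    set y := rr σ ζ * ‖W ζ‖ with hy'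
    set z := ‖mu (JJ s) (Dop U) ζ‖
    set v := ∑ i, ‖V i ζ‖
    have e1 : lam σ ζ ^ 2 * ‖W ζ‖ ^ 2 = x ^ 2 := by rw [hx']; ring
    have e2 : rr σ ζ ^ 2 * ‖W ζ‖ ^ 2 = y ^ 2 := by rw [hy']; ring
    rw [e1, e2]
    have := real_sq4 x y z v
    linarith
  · rw [integral_const_mul, integral_add iXYD (iV.const_mul _), integral_add iXY iD,
      integral_add iX iY, integral_const_mul, integral_finsetSum _ (fun i _ => integrable_sq (V i))]
    have Y0 : 0 ≤ wI (fun ζ => rr σ ζ ^ 2) W := wI_nonneg (fun _ => sq_nonneg _) _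
    have X0 : 0 ≤ wI (fun ζ => lam σ ζ ^ 2) W := wI_nonneg (fun _ => sq_nonneg _) _
    have D0 : 0 ≤ wI (fun _ => 1) (mu (JJ s) (Dop U)) := wI_nonneg (fun _ => zero_le_one) _
    have hs : ∑ i, ∫ ζ, ‖V i ζ‖ ^ 2 ≤ Q * wI (fun ζ => rr σ ζ ^ 2) W := by
      rw [hQ, Finset.sum_mul]
      exact Finset.sum_le_sum fun i _ => hVb i
    rw [← wI_one]
    set G := wI (fun _ => 1) (mu (JJ s) g) + wI (fun _ => 1) W
    have hs2 : (n:ℝ) * ∑ i, ∫ ζ, ‖V i ζ‖ ^ 2 ≤ n * (Q * (C0 * G)) := by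
      gcongr
      refine hs.trans ?_
      gcongr
      linarith
    unfold wI at K ⊢
    simp only [one_mul] at K ⊢
    linarith

end Hypo

namespace Hypo

open Function

/-! ### The symbol -/

lemma one_sub_w_tg {w : E n → ℝ} (hw : ContDiff ℝ (⊤ : ℕ∞) w)
    (hwout : ∀ η : E n, 2 ≤ ‖η‖ → w η = 1) : (fun η => 1 - w η).HasTemperateGrowth := by
  apply HasCompactSupport.hasTemperateGrowth
  · apply HasCompactSupport.of_support_subset_isCompact (isCompact_closedBall (0 : E n) 2)
    intro η hη
    rw [mem_closedBall_zero_iff]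
    by_contra hc
    exact hη (by simp [hwout η (by linarith)])
  · exact contDiff_const.sub hw

lemma Fsym_tg {σ : ℝ} {w : E n → ℝ} (hw : ContDiff ℝ (⊤ : ℕ∞) w)
    (hw01 : ∀ η, 0 ≤ w η ∧ w η ≤ 1)
    (hwout : ∀ η : E n, 2 ≤ ‖η‖ → w η = 1)
    (hwin : ∀ η : E n, ‖η‖ ≤ 1 → w η = 0) : (Fsym σ w).HasTemperateGrowth := by
  have t1 := one_sub_w_tg hw hwout
  have t2 : w.HasTemperateGrowth := by
    have := (HasTemperateGrowth.const (E := E n) (1:ℝ)).sub t1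
    convert this using 1; ext η; simp
  have t3 : (fun η : E n => 1 - w ((2:ℝ) • η)).HasTemperateGrowth :=
    t1.comp (((2:ℝ) • ContinuousLinearMap.id ℝ (E n)).hasTemperateGrowth)
  have t4 := hasTemperateGrowth_norm_sq (H := E n)
  have t5 : (fun η : E n => 4 * (‖η‖ ^ 2 + (1 - w ((2:ℝ) • η)))).HasTemperateGrowth :=
    (HasTemperateGrowth.const (4:ℝ)).mul (t4.add t3)
  have h1 : ∀ η : E n, 1 ≤ 4 * (‖η‖ ^ 2 + (1 - w ((2:ℝ) • η))) := by
    intro η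
    have h01 := hw01 ((2:ℝ) • η)
    rcases le_total ‖η‖ (1/2) with h | h
    · rw [hwin ((2:ℝ) • η) (by rw [norm_smul]; norm_num; linarith)]
      nlinarith [sq_nonneg ‖η‖]
    · nlinarith
  have t6 := tg_rpow t5 h1 σ
  have t7 : (fun η : E n => (4:ℝ) ^ (-σ) * (4 * (‖η‖ ^ 2 + (1 - w ((2:ℝ) • η)))) ^ σ * w η
      + ‖η‖ ^ 2 * (1 - w η)).HasTemperateGrowth :=
    (((HasTemperateGrowth.const ((4:ℝ) ^ (-σ))).mul t6).mul t2).add (t4.mul t1)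
  convert t7 using 1
  ext η
  unfold Fsym
  congr 1
  rcases le_total ‖η‖ 1 with h | h
  · rw [hwin η h]; simp
  · congr 1
    rw [hwout ((2:ℝ) • η) (by rw [norm_smul]; norm_num; linarith), sub_self, add_zero,
      Real.mul_rpow (by norm_num) (by positivity), ← mul_assoc, ← Real.rpow_add (by norm_num),
      neg_add_cancel, Real.rpow_zero, one_mul, ← Real.rpow_natCast, ← Real.rpow_mul (norm_nonneg _)]
    norm_num

lemma Fsym_lam {σ : ℝ} (hσ : 0 < σ) (hσ1 : σ < 1) {w : E n → ℝ}
    (hw01 : ∀ η, 0 ≤ w η ∧ w η ≤ 1)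
    (hwout : ∀ η : E n, 2 ≤ ‖η‖ → w η = 1) (ζ : Z n) :
    |Fsym σ w (vC ζ) - lam σ ζ| ≤ 10 := by
  unfold Fsym lam jv
  set y := ‖vC ζ‖ with hy
  have hy0 : 0 ≤ y := norm_nonneg _
  have h1 : y ^ (2 * σ) ≤ (1 + y ^ 2) ^ σ := norm_rpow_le hy0 hσ.le
  have h0 : 0 ≤ y ^ (2 * σ) := by positivity
  have hw := hw01 (vC ζ)
  rcases le_total 2 y with h | h
  · rw [hwout _ h]
    have h2 : (1 + y ^ 2) ^ σ ≤ 1 + y ^ (2 * σ) := by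
      have h3 := Real.rpow_add_le_add_rpow (zero_le_one) (sq_nonneg y) hσ.le hσ1.le
      rw [Real.one_rpow] at h3
      rw [Real.rpow_mul hy0, Real.rpow_two]; exact h3
    rw [abs_le]; constructor <;> linarith
  · have h3 : (1 + y ^ 2) ^ σ ≤ 5 := by
      calc (1 + y ^ 2) ^ σ ≤ (1 + y ^ 2) ^ (1:ℝ) :=
            Real.rpow_le_rpow_of_exponent_le (by nlinarith) hσ1.le
        _ = 1 + y ^ 2 := Real.rpow_one _
        _ ≤ 5 := by nlinarith
    have h4 : y ^ (2 * σ) * w (vC ζ) ≤ 5 * 1 :=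
      mul_le_mul (by linarith) hw.2 hw.1 (by norm_num)
    have h5 : 0 ≤ y ^ (2 * σ) * w (vC ζ) := mul_nonneg h0 hw.1
    have h6 : y ^ 2 * (1 - w (vC ζ)) ≤ 4 * 1 :=
      mul_le_mul (by nlinarith) (by linarith [hw.1]) (by linarith [hw.2]) (by norm_num)
    have h7 : 0 ≤ y ^ 2 * (1 - w (vC ζ)) := mul_nonneg (by positivity) (by linarith [hw.2])
    rw [abs_le]; constructor <;> linarith

/-! ### Norm conversions -/

lemma eLpNorm_le_of_sq {f : Z n → ℂ} {R : Z n → ℝ} (hR : Integrable R)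
    (h : ∀ ζ, ‖f ζ‖ ^ 2 ≤ R ζ) : eLpNorm f 2 volume ≤ ENNReal.ofReal (√(∫ ζ, R ζ)) := by
  rw [eLpNorm_eq_lintegral_rpow_enorm_toReal (by norm_num) (by norm_num)]
  have hR0 : ∀ ζ, 0 ≤ R ζ := fun ζ => (sq_nonneg _).trans (h ζ)
  have h1 : ∫⁻ ζ, ‖f ζ‖ₑ ^ (2:ENNReal).toReal ≤ ENNReal.ofReal (∫ ζ, R ζ) := by
    rw [ofReal_integral_eq_lintegral_ofReal hR (Filter.Eventually.of_forall hR0)]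
    refine lintegral_mono fun ζ => ?_
    have : ‖f ζ‖ₑ ^ (2:ENNReal).toReal = ENNReal.ofReal (‖f ζ‖ ^ 2) := by
      rw [ENNReal.ofReal_pow (norm_nonneg _), ofReal_norm]; simp
    rw [this]
    exact ENNReal.ofReal_le_ofReal (h ζ)
  rw [Real.sqrt_eq_rpow, ← ENNReal.ofReal_rpow_of_nonneg (integral_nonneg hR0) (by norm_num)]
  have : (1 / (2:ENNReal).toReal) = (1/2:ℝ) := by simp
  rw [this]
  gcongr

lemma eLpNorm_schwartz (V : 𝓢(Z n, ℂ)) :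
    eLpNorm V 2 volume = ENNReal.ofReal (√(wI (fun _ => 1) V)) := by
  have hV : MemLp V 2 volume := V.memLp 2
  rw [hV.eLpNorm_eq_integral_rpow_norm (by norm_num) (by norm_num), wI_one,
    Real.sqrt_eq_rpow]
  simp

lemma bounded_tg {a : Z n → ℝ} (ha : ContDiff ℝ (⊤ : ℕ∞) a)
    (haB : ∀ k : ℕ, ∃ C : ℝ, ∀ z, ‖iteratedFDeriv ℝ k a z‖ ≤ C) : a.HasTemperateGrowth :=
  ⟨ha, fun k => by
    obtain ⟨C, hC⟩ := haB k
    exact ⟨0, C, by simpa using hC⟩⟩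

/-! ### Fourier transform of the transport part -/

lemma inner_eT : (fun ζ : Z n => inner ℝ ζ eT) = (tC : Z n → ℝ) := by
  ext ζ; simp [eT, tC, EuclideanSpace.inner_single_right]
lemma inner_eX (i : Fin n) : (fun ζ : Z n => inner ℝ ζ (eX i)) = fun ζ => xC ζ i := by
  ext ζ; simp [eX, xC, EuclideanSpace.inner_single_right]
lemma inner_eV (i : Fin n) : (fun ζ : Z n => inner ℝ ζ (eV i)) = fun ζ => vC ζ i := by
  ext ζ; simp [eV, vC, EuclideanSpace.inner_single_right]

lemma fourier_dT (u : 𝓢(Z n, ℂ)) : 𝓕 (∂_{(eT : Z n)} u) = (2 * π * Complex.I) • mu tC (𝓕 u) := by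
  rw [SchwartzMap.fourier_lineDerivOp_eq, inner_eT]
lemma fourier_dX (i : Fin n) (u : 𝓢(Z n, ℂ)) :
    𝓕 (∂_{(eX i : Z n)} u) = (2 * π * Complex.I) • mu (fun ζ => xC ζ i) (𝓕 u) := by
  rw [SchwartzMap.fourier_lineDerivOp_eq, inner_eX]
lemma dV_fourier (i : Fin n) (u : 𝓢(Z n, ℂ)) :
    ∂_{(eV i : Z n)} (𝓕 u) = 𝓕 (-(2 * π * Complex.I) • mu (fun ζ => vC ζ i) u) := by
  rw [SchwartzMap.lineDerivOp_fourier_eq, inner_eV]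

lemma dV_mu_x (i j : Fin n) (U : 𝓢(Z n, ℂ)) :
    ∂_{(eV i : Z n)} (mu (fun ζ => xC ζ j) U) = mu (fun ζ => xC ζ j) (∂_{(eV i : Z n)} U) := by
  ext ζ
  have hc := xCi_tg (n := n) j
  have h1 : HasFDerivAt (fun ζ : Z n => xC ζ j)
      (EuclideanSpace.proj (𝕜 := ℝ) (Sum.inr (Sum.inl j)) : Z n →L[ℝ] ℝ) ζ :=
    (EuclideanSpace.proj (𝕜 := ℝ) (Sum.inr (Sum.inl j)) : Z n →L[ℝ] ℝ).hasFDerivAt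
  have h2 : DifferentiableAt ℝ (U : Z n → ℂ) ζ := U.differentiableAt
  have h3 : (mu (fun ζ => xC ζ j) U : Z n → ℂ) = fun ζ => (xC ζ j) • U ζ := by
    funext ζ; rw [mu_apply hc]; simp
  rw [SchwartzMap.lineDerivOp_apply_eq_fderiv, h3, fderiv_fun_smul h1.differentiableAt h2,
    mu_apply hc, SchwartzMap.lineDerivOp_apply_eq_fderiv, h1.fderiv]
  simp [eV]

/-- `∂_t u + v⋅∂_x u` -/
def tr (u : 𝓢(Z n, ℂ)) : 𝓢(Z n, ℂ) := ∂_{(eT : Z n)} u + ∑ i, mu (fun ζ => vC ζ i) (∂_{(eX i : Z n)} u)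

lemma fourier_tr (u : 𝓢(Z n, ℂ)) : 𝓕 (tr u) = Dop (𝓕 u) := by
  have hpi : (2 * π * Complex.I : ℂ) ≠ 0 := Complex.two_pi_I_ne_zero
  have key : ∀ i : Fin n, 𝓕 (mu (fun ζ => vC ζ i) (∂_{(eX i : Z n)} u)) =
      - mu (fun ζ => xC ζ i) (∂_{(eV i : Z n)} (𝓕 u)) := by
    intro i
    have h := dV_fourier i (∂_{(eX i : Z n)} u)
    rw [fourier_dX, FourierTransform.fourier_smul, LineDeriv.lineDerivOp_smul, dV_mu_x, neg_smul] at h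
    have := congrArg (fun f => -((2 * π * Complex.I : ℂ)⁻¹ • f)) h
    simp only [smul_smul, inv_mul_cancel₀ hpi, one_smul, smul_neg, neg_neg] at this
    exact this.symm
  unfold tr Dop
  rw [FourierTransform.fourier_add, fourier_dT, sub_eq_add_neg, ← Finset.sum_neg_distrib]
  congr 1
  rw [← Finset.sum_congr rfl (fun i _ => key i)]
  exact map_sum (FourierTransform.fourierCLM ℂ 𝓢(Z n, ℂ)) _ _

end Hypo

namespace Hypo

open Function

lemma sqrt_add_le' {x y : ℝ} (hx : 0 ≤ x) (hy : 0 ≤ y) : √(x + y) ≤ √x + √y := by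
  refine Real.sqrt_le_iff.2 ⟨by positivity, ?_⟩
  nlinarith [Real.sq_sqrt hx, Real.sq_sqrt hy, mul_nonneg (Real.sqrt_nonneg x) (Real.sqrt_nonneg y)]

/-- a smooth compactly supported function as a Schwartz function -/
lemma exists_schwartz {f : Z n → ℂ} (h1 : HasCompactSupport f) (h2 : ContDiff ℝ (⊤ : ℕ∞) f) :
    ∃ g : 𝓢(Z n, ℂ), (g : Z n → ℂ) = f := ⟨h1.toSchwartzMap h2, rfl⟩

lemma sobNorm_schwartz (s : ℝ) (V : 𝓢(Z n, ℂ)) :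
    sobNorm s (V : Z n → ℂ) = ENNReal.ofReal (√(wI (fun _ => 1) (mu (JJ s) (𝓕 V)))) := by
  rw [← eLpNorm_schwartz]
  unfold sobNorm
  congr 1
  ext ζ
  rw [mu_apply (JJ_tg s)]
  rfl

lemma Pop_schwartz {σ : ℝ} {w : E n → ℝ} {a : Z n → ℝ} (ta : a.HasTemperateGrowth)
    (tF : (fun ζ : Z n => Fsym σ w (vC ζ)).HasTemperateGrowth) (u : 𝓢(Z n, ℂ)) :
    Pop σ w a (u : Z n → ℂ) =
      (tr u + mu a (𝓕⁻ (mu (fun ζ => Fsym σ w (vC ζ)) (𝓕 u))) : 𝓢(Z n, ℂ)) := by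
  ext z
  have h1 : fracLap σ w (u : Z n → ℂ) = (𝓕⁻ (mu (fun ζ => Fsym σ w (vC ζ)) (𝓕 u)) : 𝓢(Z n, ℂ)) := by
    rw [SchwartzMap.fourierInv_coe]
    unfold fracLap
    congr 1
    ext ζ
    rw [mu_apply tF]
    rfl
  unfold Pop tr
  rw [h1, add_apply, add_apply, mu_apply ta, sum_apply,
    SchwartzMap.lineDerivOp_apply_eq_fderiv]
  congr 2
  refine Finset.sum_congr rfl fun i _ => ?_
  rw [mu_apply (vCi_tg i), SchwartzMap.lineDerivOp_apply_eq_fderiv]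

lemma fderiv_cut {χ : Z n → ℝ} {u : Z n → ℂ} (h : ∀ z ∈ tsupport u, χ z = 1) (z e : Z n) :
    (χ z : ℂ) * fderiv ℝ u z e = fderiv ℝ u z e := by
  by_cases hz : z ∈ tsupport u
  · rw [h z hz]; simp
  · have : fderiv ℝ u z = 0 := by
      by_contra hc
      exact hz (support_fderiv_subset ℝ hc)
    rw [this]; simp

theorem final (σ : ℝ) (hσ0 : 0 < σ) (hσ1 : σ < 1)
    (w : E n → ℝ) (hw : ContDiff ℝ (⊤ : ℕ∞) w)
    (hw01 : ∀ η, 0 ≤ w η ∧ w η ≤ 1)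
    (hwout : ∀ η : E n, 2 ≤ ‖η‖ → w η = 1)
    (hwin : ∀ η : E n, ‖η‖ ≤ 1 → w η = 0)
    (a : Z n → ℝ) (ha : ContDiff ℝ (⊤ : ℕ∞) a)
    (haB : ∀ k : ℕ, ∃ C : ℝ, ∀ z, ‖iteratedFDeriv ℝ k a z‖ ≤ C)
    (a₀ : ℝ) (ha₀ : 0 < a₀) (haLB : ∀ z, a₀ ≤ a z)
    (K : Set (Z n)) (hK : IsCompact K) (s : ℝ) :
    ∃ C : ℝ, 0 < C ∧ ∀ u : Z n → ℂ,
      ContDiff ℝ (⊤ : ℕ∞) u → HasCompactSupport u → tsupport u ⊆ K →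
      lhsNorm σ s u ≤ ENNReal.ofReal C * (sobNorm s (Pop σ w a u) + sobNorm s u) := by
  obtain ⟨R, hR0, hR⟩ : ∃ R : ℝ, 0 < R ∧ K ⊆ Metric.closedBall 0 R := by
    obtain ⟨R, hR⟩ := hK.isBounded.subset_closedBall (0 : Z n)
    exact ⟨max R 1, by positivity, hR.trans (Metric.closedBall_subset_closedBall (le_max_left _ _))⟩
  let χ : ContDiffBump (0 : Z n) := ⟨R, R + 1, hR0, by linarith⟩
  have hχ1 : ∀ z ∈ K, χ z = 1 := fun z hz => χ.one_of_mem_closedBall (hR hz)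
  have hχs : ContDiff ℝ (⊤ : ℕ∞) (χ : Z n → ℝ) := χ.contDiff
  have hχc : HasCompactSupport (χ : Z n → ℝ) := χ.hasCompactSupport
  have mkS : ∀ f : Z n → ℂ, ContDiff ℝ (⊤ : ℕ∞) f →
      ∃ g : 𝓢(Z n, ℂ), ∀ z, g z = (χ z : ℂ) * f z := by
    intro f hf
    have c1 : HasCompactSupport (fun z => (χ z : ℂ) * f z) := by
      refine hχc.mono ?_
      intro z hz hc
      exact hz (by simp [hc])
    have c2 : ContDiff ℝ (⊤ : ℕ∞) (fun z => (χ z : ℂ) * f z) :=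
      (Complex.ofRealCLM.contDiff.comp hχs).mul hf
    obtain ⟨g, hg⟩ := exists_schwartz c1 c2
    exact ⟨g, fun z => congrFun hg z⟩
  obtain ⟨χS, hχS⟩ := mkS (fun _ => 1) contDiff_const
  obtain ⟨b, hb⟩ := mkS (fun z => ((a z - a₀ : ℝ) : ℂ))
    (Complex.ofRealCLM.contDiff.comp (ha.sub contDiff_const))
  have hψ : ∀ i : Fin n, ∃ g : 𝓢(Z n, ℂ), ∀ z, g z =
      (χ z : ℂ) * (-(2 * π * Complex.I) * ((vC z i : ℝ) : ℂ)) := fun i => mkS _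
    (contDiff_const.mul (Complex.ofRealCLM.contDiff.comp (vCi_tg i).1))
  choose ψ hψ using hψ
  have tF : (fun ζ : Z n => Fsym σ w (vC ζ)).HasTemperateGrowth :=
    (Fsym_tg hw hw01 hwout hwin).comp vC_tg
  have ta := bounded_tg ha haB
  obtain ⟨C, hC, H⟩ := main2 hσ0 hσ1 ha₀ (b := b) (b' := fun z => χ z * (a z - a₀))
    (fun z => by rw [hb]; push_cast; ring)
    (fun z => mul_nonneg χ.nonneg (sub_nonneg.2 (haLB z))) (𝓕 χS) tF
    (Fsym_lam hσ0 hσ1 hw01 hwout) s (fun i => 𝓕 (ψ i))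
  refine ⟨√C, Real.sqrt_pos.2 hC, ?_⟩
  intro u hu huc huK
  obtain ⟨uS, rfl⟩ := exists_schwartz huc hu
  have hcut : ∀ z, (χ z : ℂ) * uS z = uS z := by
    intro z
    by_cases hz : z ∈ tsupport (uS : Z n → ℂ)
    · rw [hχ1 z (huK hz)]; simp
    · rw [image_eq_zero_of_notMem_tsupport hz]; simp
  have hcutd : ∀ z e, (χ z : ℂ) * fderiv ℝ uS z e = fderiv ℝ uS z e :=
    fderiv_cut fun z hz => hχ1 z (huK hz)
  set U := 𝓕 uS with hU
  set fl : 𝓢(Z n, ℂ) := 𝓕⁻ (mu (fun ζ => Fsym σ w (vC ζ)) U) with hfl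
  set p : 𝓢(Z n, ℂ) := tr uS + mu a fl with hp
  have hfl' : 𝓕 fl = mu (fun ζ => Fsym σ w (vC ζ)) U := by
    rw [hfl]; exact FourierTransform.fourier_fourierInv_eq _
  have hPop : Pop σ w a (uS : Z n → ℂ) = p := Pop_schwartz ta tF uS
  have htr : ∀ z, (χ z : ℂ) * tr uS z = tr uS z := by
    intro z
    unfold tr
    rw [add_apply, sum_apply, SchwartzMap.lineDerivOp_apply_eq_fderiv,
      mul_add, hcutd, Finset.mul_sum]
    congr 1
    refine Finset.sum_congr rfl fun i _ => ?_
    rw [mu_apply (vCi_tg i), SchwartzMap.lineDerivOp_apply_eq_fderiv, mul_left_comm, hcutd]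
  obtain ⟨χf, hχf⟩ := mkS fl (fl.smooth _)
  obtain ⟨bf, hbf⟩ := mkS (fun z => ((a z - a₀ : ℝ) : ℂ) * fl z)
    ((Complex.ofRealCLM.contDiff.comp (ha.sub contDiff_const)).mul (fl.smooth _))
  have e1 : 𝓕 χf = conv (𝓕 χS) (mu (fun ζ => Fsym σ w (vC ζ)) U) := by
    rw [← hfl']; exact fourier_mul fun z => by rw [hχf, hχS, mul_one]
  have e2 : 𝓕 bf = conv (𝓕 b) (mu (fun ζ => Fsym σ w (vC ζ)) U) := by
    rw [← hfl']; exact fourier_mul fun z => by rw [hbf, hb, mul_assoc]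
  have e3 : 𝓕 (tr uS + (a₀ : ℂ) • χf + bf) = conv (𝓕 χS) (𝓕 p) := by
    refine fourier_mul fun z => ?_
    rw [hχS, hp]
    simp only [add_apply, smul_apply, smul_eq_mul]
    rw [mu_apply ta, hχf, hbf]
    push_cast
    linear_combination (-1 : ℂ) * htr z
  obtain ⟨Rf, hRi, hRb, hRI⟩ := H U (𝓕 p)
    (by
      rw [hU]; symm
      exact fourier_mul fun z => by rw [hχS, mul_one, hcut])
    (by
      intro ζ
      rw [← e3, FourierTransform.fourier_add, FourierTransform.fourier_add,
        FourierTransform.fourier_smul, fourier_tr, e1, e2]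
      simp only [add_apply, smul_apply, smul_eq_mul]
      rfl)
    (by
      intro i ζ
      rw [← SchwartzMap.lineDerivOp_apply_eq_fderiv, hU, dV_fourier]
      congr 1
      refine fourier_mul fun z => ?_
      rw [smul_apply, mu_apply (vCi_tg i), hψ, smul_eq_mul]
      linear_combination (-(-(2 * π * Complex.I) * ((vC z i : ℝ) : ℂ))) * hcut z)
  have hl : lhsNorm σ s (uS : Z n → ℂ) ≤ ENNReal.ofReal (√(∫ ζ, Rf ζ)) :=
    eLpNorm_le_of_sq hRi hRb
  rw [hPop, sobNorm_schwartz, sobNorm_schwartz, ← hU,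
    ← ENNReal.ofReal_add (Real.sqrt_nonneg _) (Real.sqrt_nonneg _),
    ← ENNReal.ofReal_mul (Real.sqrt_nonneg _)]
  refine hl.trans (ENNReal.ofReal_le_ofReal ?_)
  refine (Real.sqrt_le_sqrt hRI).trans ?_
  rw [Real.sqrt_mul hC.le]
  gcongr
  exact sqrt_add_le' (wI_nonneg (fun _ => zero_le_one) _) (wI_nonneg (fun _ => zero_le_one) _)

end Hypo

/-- Theorem 1.1: optimal hypoelliptic estimate in `H^s`
for smooth compactly supported functions with support in a fixed compact set `K`. -/
theorem statement0
    (n : ℕ) (hn : 1 ≤ n) (σ : ℝ) (hσ0 : 0 < σ) (hσ1 : σ < 1)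
    (w : E n → ℝ) (hw : ContDiff ℝ (⊤ : ℕ∞) w)
    (hw01 : ∀ η, 0 ≤ w η ∧ w η ≤ 1)
    (hwout : ∀ η : E n, 2 ≤ ‖η‖ → w η = 1)
    (hwin : ∀ η : E n, ‖η‖ ≤ 1 → w η = 0)
    (a : Z n → ℝ) (ha : ContDiff ℝ (⊤ : ℕ∞) a)
    (haB : ∀ k : ℕ, ∃ C : ℝ, ∀ z, ‖iteratedFDeriv ℝ k a z‖ ≤ C)
    (a₀ : ℝ) (ha₀ : 0 < a₀) (haLB : ∀ z, a₀ ≤ a z)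
    (K : Set (Z n)) (hK : IsCompact K) (s : ℝ) :
    ∃ C : ℝ, 0 < C ∧ ∀ u : Z n → ℂ,
      ContDiff ℝ (⊤ : ℕ∞) u → HasCompactSupport u → tsupport u ⊆ K →
      lhsNorm σ s u ≤ ENNReal.ofReal C * (sobNorm s (Pop σ w a u) + sobNorm s u) := by
  exact Hypo.final σ hσ0 hσ1 w hw hw01 hwout hwin a ha haB a₀ ha₀ haLB K hK s
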